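/- arXiv:2309.11885 — 3 statements merged into one kernel-verified Lean document; each statement's English description precedes it below -/
import Mathlib

section
/- Let T be a finite tree and u a vertex of T with degree at least 3. Then there exists a neighbor v of u such that μ(T; v) > μ(T; u). -/
open Finset Polynomial

variable {V : Type*}

/-- The vertex sets of the subtrees of `G` that lie inside the set `S` and contain
the vertex `w` : nonempty connected induced subgraphs. -/
noncomputable def subtreesIn [Fintype V] [DecidableEq V] (G : SimpleGraph V) (S : Set V)
    (w : V) : Finset (Finset V) := by
  classical
  exact Finset.univ.filter fun A => w ∈ A ∧ (A : Set V) ⊆ S ∧ (G.induce (A : Set V)).Connected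

/-- The vertex sets of the subtrees of `G` containing `w`. -/
noncomputable def subtrees [Fintype V] [DecidableEq V] (G : SimpleGraph V) (w : V) :
    Finset (Finset V) := subtreesIn G Set.univ w

/-- The generating polynomial `φ_{T,w}` of subtrees of `G` inside `S` containing `w`,
counted by order. -/
noncomputable def subtreePolyIn [Fintype V] [DecidableEq V] (G : SimpleGraph V) (S : Set V)
    (w : V) : Polynomial ℝ := ∑ A ∈ subtreesIn G S w, X ^ A.card

/-- The generating polynomial `φ_{T,w}` of subtrees of `G` containing `w`. -/
noncomputable def subtreePoly [Fintype V] [DecidableEq V] (G : SimpleGraph V) (w : V) :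
    Polynomial ℝ := subtreePolyIn G Set.univ w

/-- The local mean subtree order `μ(G; w)`: the average order of subtrees of `G`
containing `w`. -/
noncomputable def meanOrder [Fintype V] [DecidableEq V] (G : SimpleGraph V) (w : V) : ℝ :=
  (∑ A ∈ subtrees G w, (A.card : ℝ)) / ((subtrees G w).card : ℝ)

/-- The vertex set of the connected component of `G - D` containing `w`. -/
def compDel (G : SimpleGraph V) (D : Set V) (w : V) : Set V :=
  {x | ∃ p : G.Walk w x, ∀ y ∈ p.support, y ∉ D}

/-- The neighbours of `u` as a `Finset`. -/
noncomputable def nbrFinset [Fintype V] (G : SimpleGraph V) (u : V) : Finset V := by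
  classical
  exact Finset.univ.filter fun w => G.Adj u w

/-- `G` is a path: a tree all of whose vertices have degree at most `2`. -/
def IsPathGraph [Fintype V] (G : SimpleGraph V) : Prop :=
  G.IsTree ∧ ∀ v : V, (G.neighborSet v).ncard ≤ 2

/-- The induced subgraph of `G` on `S` is a path (as a subgraph of a tree:
connected with all degrees within `S` at most `2`). -/
def IsPathOn (G : SimpleGraph V) (S : Set V) : Prop :=
  (G.induce S).Connected ∧ ∀ x ∈ S, (G.neighborSet x ∩ S).ncard ≤ 2

/-- The partial Kelmans operation on `G` from `v` to `u`, moving the edges between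
`v` and the set `W`: each edge `v w`, `w ∈ W`, is replaced by the edge `u w`. -/
def pkelmans (G : SimpleGraph V) (v u : V) (W : Set V) : SimpleGraph V :=
  SimpleGraph.fromRel fun a b =>
    (G.Adj a b ∧ ¬(a = v ∧ b ∈ W) ∧ ¬(b = v ∧ a ∈ W)) ∨
    (a = u ∧ b ∈ W ∧ G.Adj v b)

/-- The Kelmans operation on `G` from `v` to `u`: every edge `v w` with
`w ∈ N(v) \ {u}` is replaced by the edge `u w`. -/
def kelmans (G : SimpleGraph V) (v u : V) : SimpleGraph V :=
  pkelmans G v u (G.neighborSet v \ {u})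
/-- Adjacency in `G` between two vertices of `A`. -/
def stepIn (G : SimpleGraph V) (A : Set V) (x y : V) : Prop :=
  G.Adj x y ∧ x ∈ A ∧ y ∈ A

theorem reflTransGen_stepIn_mono {G : SimpleGraph V} {A B : Set V} (h : A ⊆ B) {x y : V}
    (hxy : Relation.ReflTransGen (stepIn G A) x y) : Relation.ReflTransGen (stepIn G B) x y :=
  hxy.lift id fun _ _ hab => ⟨hab.1, h hab.2.1, h hab.2.2⟩

theorem induce_connected_iff_reflTransGen (G : SimpleGraph V) (A : Set V) {w : V} (hw : w ∈ A) :
    (G.induce A).Connected ↔ ∀ y ∈ A, Relation.ReflTransGen (stepIn G A) w y := by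
  constructor
  · intro h y hy
    have hr := h.preconnected ⟨w, hw⟩ ⟨y, hy⟩
    rw [SimpleGraph.reachable_iff_reflTransGen] at hr
    exact hr.lift Subtype.val fun a b hab => ⟨hab, a.2, b.2⟩
  · intro h
    have key : ∀ y, Relation.ReflTransGen (stepIn G A) w y →
        ∃ hy : y ∈ A, (G.induce A).Reachable ⟨w, hw⟩ ⟨y, hy⟩ := by
      intro y hy
      induction hy with
      | refl => exact ⟨hw, SimpleGraph.Reachable.refl _⟩
      | tail _ hbc ih =>
        obtain ⟨_, hr⟩ := ih
        exact ⟨hbc.2.2, hr.trans (SimpleGraph.Adj.reachable (by simpa using hbc.1))⟩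
    rw [SimpleGraph.connected_iff_exists_forall_reachable]
    exact ⟨⟨w, hw⟩, fun y => (key y (h y y.2)).2⟩

section Subtrees

variable [Fintype V] [DecidableEq V]

theorem mem_subtreesIn {G : SimpleGraph V} {S : Set V} {w : V} {A : Finset V} :
    A ∈ subtreesIn G S w ↔ w ∈ A ∧ (A : Set V) ⊆ S ∧
      ∀ y ∈ A, Relation.ReflTransGen (stepIn G A) w y := by
  unfold subtreesIn
  simp only [Finset.mem_filter, Finset.mem_univ, true_and]
  refine and_congr_right fun hw => and_congr_right fun _ => ?_
  simpa using induce_connected_iff_reflTransGen G (A : Set V) (w := w) (by simpa using hw)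

theorem singleton_mem_subtreesIn (G : SimpleGraph V) {S : Set V} {w : V} (hw : w ∈ S) :
    {w} ∈ subtreesIn G S w := by
  rw [mem_subtreesIn]
  refine ⟨by simp, by simpa using hw, fun y hy => ?_⟩
  rw [Finset.mem_singleton.1 hy]

theorem card_subtreesIn_pos (G : SimpleGraph V) {S : Set V} {w : V} (hw : w ∈ S) :
    0 < (subtreesIn G S w).card :=
  Finset.card_pos.2 ⟨_, singleton_mem_subtreesIn G hw⟩

theorem card_subtreesIn_le_sum (G : SimpleGraph V) (S : Set V) (w : V) :
    (subtreesIn G S w).card ≤ ∑ A ∈ subtreesIn G S w, A.card := by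
  rw [Finset.card_eq_sum_ones]
  exact Finset.sum_le_sum fun A hA => Finset.card_pos.2 ⟨w, (mem_subtreesIn.1 hA).1⟩

theorem exists_insert_mem_subtreesIn {G : SimpleGraph V} {S : Set V} {w : V} {A B : Finset V}
    (hA : A ∈ subtreesIn G S w) (hB : B ∈ subtreesIn G S w) (hAB : ¬ A ⊆ B) :
    ∃ y ∈ A, y ∉ B ∧ insert y B ∈ subtreesIn G S w := by
  rw [mem_subtreesIn] at hA hB
  obtain ⟨x, y, hxB, hyB, hxy⟩ : ∃ x y, x ∈ B ∧ y ∉ B ∧ stepIn G A x y := by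
    by_contra! hcon
    refine hAB fun y hy => ?_
    have hwy := hA.2.2 y hy
    clear hy
    induction hwy with
    | refl => exact hB.1
    | tail _ hbc ih => exact by_contra fun hc => hcon _ _ ih hc hbc
  refine ⟨y, by simpa using hxy.2.2, hyB, mem_subtreesIn.2 ⟨by simp [hB.1], ?_, ?_⟩⟩
  · rw [Finset.coe_insert]
    exact Set.insert_subset (hA.2.1 hxy.2.2) hB.2.1
  · have hsub : (B : Set V) ⊆ (insert y B : Finset V) := by simp
    intro z hz
    rcases Finset.mem_insert.1 hz with rfl | hz
    · exact (reflTransGen_stepIn_mono hsub (hB.2.2 x hxB)).tail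
        ⟨hxy.1, by simp [hxB], by simp⟩
    · exact reflTransGen_stepIn_mono hsub (hB.2.2 z hz)

theorem exists_subset_mem_subtreesIn_card_eq {G : SimpleGraph V} {S : Set V} {w : V}
    {A : Finset V} (hA : A ∈ subtreesIn G S w) {k : ℕ} (hk : 1 ≤ k) (hkA : k ≤ A.card) :
    ∃ B ∈ subtreesIn G S w, B ⊆ A ∧ B.card = k := by
  have hA' := mem_subtreesIn.1 hA
  induction k, hk using Nat.le_induction with
  | base =>
    exact ⟨{w}, singleton_mem_subtreesIn G (hA'.2.1 (by simpa using hA'.1)),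
      by simpa using hA'.1, by simp⟩
  | succ k _ ih =>
    obtain ⟨B, hB, hBA, hBk⟩ := ih (by omega)
    obtain ⟨y, hyA, hyB, hy⟩ := exists_insert_mem_subtreesIn hA hB fun h => by
      have := Finset.card_le_card h
      omega
    exact ⟨_, hy, Finset.insert_subset hyA hBA, by simp [hyB, hBk]⟩

theorem card_le_card_filter_subset {G : SimpleGraph V} {S : Set V} {w : V} {A : Finset V}
    (hA : A ∈ subtreesIn G S w) :
    A.card ≤ ((subtreesIn G S w).filter fun B => B ⊆ A).card := by
  calc A.card = (Finset.Icc 1 A.card).card := by simp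
    _ ≤ (((subtreesIn G S w).filter fun B => B ⊆ A).image Finset.card).card := by
      refine Finset.card_le_card fun k hk => ?_
      rw [Finset.mem_Icc] at hk
      obtain ⟨B, hB, hBA, hBk⟩ := exists_subset_mem_subtreesIn_card_eq hA hk.1 hk.2
      exact Finset.mem_image.2 ⟨B, by simp [hB, hBA], hBk⟩
    _ ≤ _ := Finset.card_image_le

/-- The mean order of the subtrees containing `w` is at most `(a + 1) / 2`, where `a` is their
number. -/
theorem two_mul_sum_card_subtreesIn_le (G : SimpleGraph V) (S : Set V) (w : V) :
    2 * ∑ A ∈ subtreesIn G S w, A.card ≤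
      (subtreesIn G S w).card * ((subtreesIn G S w).card + 1) := by
  set F := subtreesIn G S w
  have h : ∑ A ∈ F, A.card ≤ ∑ A ∈ F, ∑ B ∈ F, if B ⊆ A then 1 else 0 :=
    Finset.sum_le_sum fun A hA => by
      rw [← Finset.card_filter]
      exact card_le_card_filter_subset hA
  have h' : ∑ A ∈ F, A.card ≤ ∑ A ∈ F, ∑ B ∈ F, if A ⊆ B then 1 else 0 := by
    rw [Finset.sum_comm]
    exact h
  calc 2 * ∑ A ∈ F, A.card
      ≤ ∑ A ∈ F, ∑ B ∈ F, ((if B ⊆ A then 1 else 0) + if A ⊆ B then 1 else 0) := by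
        simp only [Finset.sum_add_distrib]
        omega
    _ ≤ ∑ A ∈ F, ∑ B ∈ F, (1 + if A = B then 1 else 0) := by
        refine Finset.sum_le_sum fun A _ => Finset.sum_le_sum fun B _ => ?_
        by_cases h1 : A = B
        · simp [h1]
        · by_cases h2 : A ⊆ B
          · have : ¬ B ⊆ A := fun h3 => h1 (h2.antisymm h3)
            simp [h1, h2, this]
          · simp only [h1, h2, if_false]
            split_ifs <;> simp
    _ = F.card * (F.card + 1) := by
        simp [Finset.sum_add_distrib, mul_add]

end Subtrees

/-- The sets `S ∋ u` and `T ∋ v` are disjoint and `uv` is the only edge of `G` between them. -/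
structure IsBridgeBetween (G : SimpleGraph V) (S T : Set V) (u v : V) : Prop where
  disjoint : Disjoint S T
  left_mem : u ∈ S
  right_mem : v ∈ T
  adj : G.Adj u v
  eq_of_adj : ∀ ⦃x y⦄, x ∈ S → y ∈ T → G.Adj x y → x = u ∧ y = v

namespace IsBridgeBetween

theorem symm {G : SimpleGraph V} {S T : Set V} {u v : V} (h : IsBridgeBetween G S T u v) :
    IsBridgeBetween G T S v u :=
  ⟨h.disjoint.symm, h.right_mem, h.left_mem, h.adj.symm,
    fun _ _ hx hy hxy => (h.eq_of_adj hy hx hxy.symm).symm⟩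

/-- Contracting the part of `A` in `T` to `u` preserves connectedness. -/
theorem reflTransGen_inter {G : SimpleGraph V} {S T A : Set V} {u v x y : V}
    (h : IsBridgeBetween G S T u v) (hA : A ⊆ S ∪ T)
    (hxy : Relation.ReflTransGen (stepIn G A) x y) (hx : x = u ∨ x ∈ T) (hy : y ∈ S) :
    Relation.ReflTransGen (stepIn G (A ∩ S)) u y := by
  classical
  have hTS : ∀ z ∈ T, z ∉ S := fun z hz hz' => Set.disjoint_left.1 h.disjoint hz' hz
  have key := hxy.lift' (p := stepIn G (A ∩ S)) (fun z => if z ∈ S then z else u) (by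
    rintro a b ⟨hab, ha, hb⟩
    unfold Function.onFun
    rcases hA ha with haS | haT <;> rcases hA hb with hbS | hbT
    · simpa [haS, hbS] using Relation.ReflTransGen.single (r := stepIn G (A ∩ S))
        ⟨hab, ⟨ha, haS⟩, hb, hbS⟩
    · obtain ⟨rfl, rfl⟩ := h.eq_of_adj haS hbT hab
      simpa [haS, hTS _ hbT] using Relation.ReflTransGen.refl
    · obtain ⟨rfl, rfl⟩ := h.eq_of_adj hbS haT hab.symm
      simpa [hbS, hTS _ haT] using Relation.ReflTransGen.refl
    · simpa [hTS a haT, hTS b hbT] using Relation.ReflTransGen.refl)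
  have hx' : (if x ∈ S then x else u) = u := by
    rcases hx with rfl | hx
    · simp
    · simp [hTS x hx]
  unfold Function.onFun at key
  simpa [hx', hy] using key

theorem right_mem_of_reflTransGen {G : SimpleGraph V} {S T A : Set V} {u v y : V}
    (h : IsBridgeBetween G S T u v) (hA : A ⊆ S ∪ T)
    (hy : Relation.ReflTransGen (stepIn G A) u y) (hyT : y ∈ T) : v ∈ A := by
  by_contra hv
  have key : y ∈ S := by
    clear hyT
    induction hy with
    | refl => exact h.left_mem
    | tail _ hbc ih =>
      rcases hA hbc.2.2 with hc | hc
      · exact hc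
      · exact absurd ((h.eq_of_adj ih hc hbc.1).2 ▸ hbc.2.2) hv
  exact Set.disjoint_left.1 h.disjoint key hyT

variable [Fintype V] [DecidableEq V]

theorem subtreesIn_union {G : SimpleGraph V} {S T : Set V} {u v : V}
    (h : IsBridgeBetween G S T u v) :
    subtreesIn G (S ∪ T) u = subtreesIn G S u ∪
      (subtreesIn G S u ×ˢ subtreesIn G T v).image fun p => p.1 ∪ p.2 := by
  classical
  ext A
  rw [Finset.mem_union, Finset.mem_image]
  constructor
  · intro hA
    obtain ⟨huA, hAST, hA⟩ := mem_subtreesIn.1 hA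
    have hcoe : ∀ R : Set V, ((A.filter (· ∈ R) : Finset V) : Set V) = (A : Set V) ∩ R := by
      intro R
      ext
      simp
    have hAS : A.filter (· ∈ S) ∈ subtreesIn G S u := by
      rw [mem_subtreesIn, hcoe]
      refine ⟨by simp [huA, h.left_mem], Set.inter_subset_right, fun y hy => ?_⟩
      rw [Finset.mem_filter] at hy
      exact h.reflTransGen_inter hAST (hA y hy.1) (Or.inl rfl) hy.2
    by_cases hT : ∃ y ∈ A, y ∈ T
    · obtain ⟨y, hyA, hyT⟩ := hT
      have hvA : v ∈ A := by
        simpa using h.right_mem_of_reflTransGen hAST (hA y hyA) hyT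
      refine Or.inr ⟨(A.filter (· ∈ S), A.filter (· ∈ T)), Finset.mem_product.2 ⟨hAS, ?_⟩, ?_⟩
      · rw [mem_subtreesIn, hcoe]
        refine ⟨by simp [hvA, h.right_mem], Set.inter_subset_right, fun z hz => ?_⟩
        rw [Finset.mem_filter] at hz
        exact h.symm.reflTransGen_inter (hAST.trans (Set.union_comm S T).subset) (hA z hz.1)
          (Or.inr h.left_mem) hz.2
      · ext z
        have : z ∈ A → z ∈ S ∨ z ∈ T := fun hz => hAST (by simpa using hz)
        simp only [Finset.mem_union, Finset.mem_filter]
        tauto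
    · left
      rwa [Finset.filter_true_of_mem] at hAS
      intro z hz
      exact (hAST (by simpa using hz)).resolve_right fun hzT => hT ⟨z, hz, hzT⟩
  · rintro (hA | ⟨⟨B, C⟩, hBC, rfl⟩)
    · rw [mem_subtreesIn] at hA ⊢
      exact ⟨hA.1, hA.2.1.trans Set.subset_union_left, hA.2.2⟩
    · obtain ⟨hB, hC⟩ := Finset.mem_product.1 hBC
      simp only [mem_subtreesIn] at hB hC ⊢
      rw [Finset.coe_union]
      refine ⟨Finset.mem_union_left _ hB.1, Set.union_subset_union hB.2.1 hC.2.1, fun y hy => ?_⟩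
      rcases Finset.mem_union.1 hy with hy | hy
      · exact reflTransGen_stepIn_mono Set.subset_union_left (hB.2.2 y hy)
      · exact (reflTransGen_stepIn_mono Set.subset_union_right (hC.2.2 y hy)).head
          ⟨h.adj, Or.inl hB.1, Or.inr hC.1⟩

theorem sum_subtreesIn_union {G : SimpleGraph V} {S T : Set V} {u v : V}
    (h : IsBridgeBetween G S T u v) (f : Finset V → ℕ) :
    ∑ A ∈ subtreesIn G (S ∪ T) u, f A = ∑ A ∈ subtreesIn G S u, f A +
      ∑ A ∈ subtreesIn G S u, ∑ B ∈ subtreesIn G T v, f (A ∪ B) := by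
  classical
  rw [h.subtreesIn_union, Finset.sum_union, Finset.sum_image, Finset.sum_product]
  · rintro ⟨A, B⟩ hAB ⟨A', B'⟩ hAB' heq
    simp only [Finset.coe_product, Set.mem_prod, Finset.mem_coe, mem_subtreesIn] at hAB hAB'
    have hd := Set.disjoint_left.1 h.disjoint
    have hz : ∀ z, z ∈ A ∨ z ∈ B ↔ z ∈ A' ∨ z ∈ B' := fun z => by
      simpa using Finset.ext_iff.1 heq z
    have h1 : ∀ z ∈ A, z ∈ S := fun z hz => hAB.1.2.1 hz
    have h2 : ∀ z ∈ B, z ∈ T := fun z hz => hAB.2.2.1 hz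
    have h3 : ∀ z ∈ A', z ∈ S := fun z hz => hAB'.1.2.1 hz
    have h4 : ∀ z ∈ B', z ∈ T := fun z hz => hAB'.2.2.1 hz
    refine Prod.ext (Finset.ext fun z => ?_) (Finset.ext fun z => ?_)
    · have := @hd z; have := hz z; have := h1 z; have := h2 z; have := h3 z; have := h4 z
      tauto
    · have := @hd z; have := hz z; have := h1 z; have := h2 z; have := h3 z; have := h4 z
      tauto
  · rw [Finset.disjoint_left]
    rintro A hA hA'
    obtain ⟨⟨B, C⟩, hBC, rfl⟩ := Finset.mem_image.1 hA'
    simp only [Finset.mem_product, mem_subtreesIn] at hBC hA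
    exact Set.disjoint_left.1 h.disjoint
      (hA.2.1 (Finset.mem_coe.2 (Finset.mem_union_right _ hBC.2.1))) h.right_mem

theorem card_subtreesIn_union {G : SimpleGraph V} {S T : Set V} {u v : V}
    (h : IsBridgeBetween G S T u v) :
    (subtreesIn G (S ∪ T) u).card =
      (subtreesIn G S u).card * (1 + (subtreesIn G T v).card) := by
  simp only [Finset.card_eq_sum_ones, h.sum_subtreesIn_union]
  simp [mul_add]

theorem sum_card_subtreesIn_union {G : SimpleGraph V} {S T : Set V} {u v : V}
    (h : IsBridgeBetween G S T u v) :
    ∑ A ∈ subtreesIn G (S ∪ T) u, A.card =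
      (∑ A ∈ subtreesIn G S u, A.card) * (1 + (subtreesIn G T v).card) +
        (subtreesIn G S u).card * ∑ B ∈ subtreesIn G T v, B.card := by
  have hdisj : ∑ A ∈ subtreesIn G S u, ∑ B ∈ subtreesIn G T v, (A ∪ B).card =
      ∑ A ∈ subtreesIn G S u, ∑ B ∈ subtreesIn G T v, (A.card + B.card) := by
    refine Finset.sum_congr rfl fun A hA => Finset.sum_congr rfl fun B hB =>
      Finset.card_union_of_disjoint ?_
    rw [← Finset.disjoint_coe]
    exact h.disjoint.mono (mem_subtreesIn.1 hA).2.1 (mem_subtreesIn.1 hB).2.1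
  rw [h.sum_subtreesIn_union, hdisj]
  simp only [Finset.sum_add_distrib, Finset.sum_const, smul_eq_mul, ← Finset.mul_sum]
  ring

/-- Moving along an edge `uv` that separates the graph increases the local mean order when the
`v`-side has few enough subtrees. -/
theorem meanOrder_lt {G : SimpleGraph V} {S T : Set V} {u v : V}
    (h : IsBridgeBetween G S T u v) (huniv : S ∪ T = Set.univ)
    (hlt : (∑ A ∈ subtreesIn G S u, A.card) * (1 + (subtreesIn G T v).card) <
      (subtreesIn G S u).card * (1 + (subtreesIn G S u).card)) :
    meanOrder G u < meanOrder G v := by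
  have hT := card_subtreesIn_pos G h.right_mem
  have hS := card_subtreesIn_pos G h.left_mem
  have hTs := card_subtreesIn_le_sum G T v
  have h1 := h.card_subtreesIn_union
  have h2 := h.sum_card_subtreesIn_union
  have h3 := h.symm.card_subtreesIn_union
  have h4 := h.symm.sum_card_subtreesIn_union
  rw [Set.union_comm T S] at h3 h4
  rw [huniv] at h1 h2 h3 h4
  simp only [meanOrder, subtrees, ← Nat.cast_sum]
  rw [h1, h2, h3, h4]
  generalize (subtreesIn G T v).card = a at *
  generalize (subtreesIn G S u).card = p at *
  generalize ∑ A ∈ subtreesIn G T v, A.card = s at *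
  generalize ∑ A ∈ subtreesIn G S u, A.card = r at *
  rw [div_lt_div_iff₀ (by positivity) (by positivity)]
  norm_cast
  have := (Nat.mul_lt_mul_of_pos_left hlt hT).trans_le (Nat.mul_le_mul_right _ hTs)
  linarith

end IsBridgeBetween

section Branch

variable {G : SimpleGraph V} {u v w : V}

theorem self_mem_compDel (h : G.Adj u v) : v ∈ compDel G {u} v :=
  ⟨SimpleGraph.Walk.nil, by simpa using h.ne'⟩

theorem not_mem_compDel (G : SimpleGraph V) (u v : V) : u ∉ compDel G {u} v :=
  fun ⟨p, hp⟩ => hp u p.end_mem_support rfl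

theorem eq_of_adj_of_mem_compDel (hG : G.IsAcyclic) (hv : G.Adj u v) (hw : G.Adj u w)
    (hmem : w ∈ compDel G {u} v) : v = w := by
  classical
  obtain ⟨p, hp⟩ := hmem
  have hpath : (SimpleGraph.Walk.cons hv p.bypass).IsPath := by
    rw [SimpleGraph.Walk.cons_isPath_iff]
    exact ⟨p.bypass_isPath, fun hu => hp u (p.support_bypass_subset_support hu) rfl⟩
  have hpath' : (SimpleGraph.Walk.cons hw SimpleGraph.Walk.nil).IsPath := by
    rw [SimpleGraph.Walk.cons_isPath_iff]
    simpa using hw.ne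
  have heq := congrArg (fun q : G.Path u w => q.1.length)
    ((hG.subsingleton_path u w).elim ⟨_, hpath⟩ ⟨_, hpath'⟩)
  simp only [SimpleGraph.Walk.length_cons, SimpleGraph.Walk.length_nil] at heq
  exact SimpleGraph.Walk.eq_of_length_eq_zero (p := p.bypass) (by omega)

theorem disjoint_compDel (hG : G.IsAcyclic) (hv : G.Adj u v) (hw : G.Adj u w) (hne : v ≠ w) :
    Disjoint (compDel G {u} v) (compDel G {u} w) := by
  rw [Set.disjoint_left]
  rintro x ⟨p, hp⟩ ⟨q, hq⟩
  refine hne (eq_of_adj_of_mem_compDel hG hv hw ⟨p.append q.reverse, fun y hy => ?_⟩)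
  rw [SimpleGraph.Walk.mem_support_append_iff, SimpleGraph.Walk.support_reverse,
    List.mem_reverse] at hy
  exact hy.elim (hp y) (hq y)

theorem isBridgeBetween_compDel (hG : G.IsAcyclic) (hv : G.Adj u v) {S : Set V} (hu : u ∈ S)
    (hS : Disjoint S (compDel G {u} v)) : IsBridgeBetween G S (compDel G {u} v) u v where
  disjoint := hS
  left_mem := hu
  right_mem := self_mem_compDel hv
  adj := hv
  eq_of_adj x y hx hy hxy := by
    have hxu : x = u := by
      by_contra hne
      obtain ⟨p, hp⟩ := hy
      refine Set.disjoint_left.1 hS hx ⟨p.concat hxy.symm, fun z hz => ?_⟩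
      rw [SimpleGraph.Walk.support_concat, List.mem_append, List.mem_singleton] at hz
      rcases hz with hz | rfl
      · exact hp z hz
      · exact hne
    subst hxu
    exact ⟨rfl, (eq_of_adj_of_mem_compDel hG hv hxy hy).symm⟩

end Branch

/-- If `u` is a vertex of degree at least `3` in a tree `T`, then some
neighbour `v` of `u` satisfies `μ(T; v) > μ(T; u)`. -/
theorem exists_neighbor_meanOrder_gt {V : Type*} [Fintype V] [DecidableEq V]
    (G : SimpleGraph V) (hG : G.IsTree) (u : V) (hu : 3 ≤ (G.neighborSet u).ncard) :
    ∃ v : V, G.Adj u v ∧ meanOrder G v > meanOrder G u := by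
  classical
  have hacyc : G.IsAcyclic := hG.2
  set a : V → ℕ := fun x => (subtreesIn G (compDel G {u} x) x).card
  obtain ⟨v, hv, hmin⟩ := (G.neighborSet u).toFinite.toFinset.exists_min_image a
    (by
      rw [← Finset.card_pos, ← Set.ncard_eq_toFinset_card _]
      omega)
  simp only [Set.Finite.mem_toFinset, SimpleGraph.mem_neighborSet] at hv hmin
  obtain ⟨w, ⟨hw, hwv⟩, x, ⟨hx, hxv⟩, hwx⟩ :
      ∃ w ∈ G.neighborSet u \ {v}, ∃ x ∈ G.neighborSet u \ {v}, w ≠ x := by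
    have hcard := Set.ncard_sdiff_singleton_add_one (s := G.neighborSet u) (a := v) hv
    obtain ⟨w, hw, x, hx, hwx⟩ :=
      (Set.one_lt_ncard (s := G.neighborSet u \ {v})).1 (by omega)
    exact ⟨w, hw, x, hx, hwx⟩
  refine ⟨v, hv, ?_⟩
  have hvw := disjoint_compDel hacyc hv hw (Ne.symm hwv)
  have hvx := disjoint_compDel hacyc hv hx (Ne.symm hxv)
  have hwx' := disjoint_compDel hacyc hw hx hwx
  have huv := not_mem_compDel G u v
  have huw := not_mem_compDel G u w
  have hux := not_mem_compDel G u x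
  set Bv := compDel G {u} v
  set Bw := compDel G {u} w
  set Bx := compDel G {u} x
  have hbv : IsBridgeBetween G Bvᶜ Bv u v :=
    isBridgeBetween_compDel hacyc hv huv disjoint_compl_left
  have hbw : IsBridgeBetween G (Bv ∪ Bw)ᶜ Bw u w :=
    isBridgeBetween_compDel hacyc hw (by simp [huv, huw])
      (disjoint_compl_left.mono_right Set.subset_union_right)
  have hbx : IsBridgeBetween G (Bv ∪ Bw ∪ Bx)ᶜ Bx u x :=
    isBridgeBetween_compDel hacyc hx (by simp [huv, huw, hux])
      (disjoint_compl_left.mono_right Set.subset_union_right)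
  have hunw : (Bv ∪ Bw)ᶜ ∪ Bw = Bvᶜ := by
    ext z
    have h1 : z ∈ Bv → z ∉ Bw := fun h => Set.disjoint_left.1 hvw h
    simp only [Set.mem_union, Set.mem_compl_iff]
    tauto
  have hunx : (Bv ∪ Bw ∪ Bx)ᶜ ∪ Bx = (Bv ∪ Bw)ᶜ := by
    ext z
    have h1 : z ∈ Bv → z ∉ Bx := fun h => Set.disjoint_left.1 hvx h
    have h2 : z ∈ Bw → z ∉ Bx := fun h => Set.disjoint_left.1 hwx' h
    simp only [Set.mem_union, Set.mem_compl_iff]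
    tauto
  refine hbv.meanOrder_lt (Set.compl_union_self _) ?_
  have hp := hbw.card_subtreesIn_union
  have hr := hbw.sum_card_subtreesIn_union
  have hd := hbx.card_subtreesIn_union
  have hd0 := card_subtreesIn_pos G hbx.left_mem
  rw [hunw] at hp hr
  rw [hunx] at hd
  have h1 := two_mul_sum_card_subtreesIn_le G (Bv ∪ Bw)ᶜ u
  have h2 := two_mul_sum_card_subtreesIn_le G Bw w
  have hvw_le : (subtreesIn G Bv v).card ≤ (subtreesIn G Bw w).card := hmin w hw
  have hvx_le : (subtreesIn G Bv v).card ≤ (subtreesIn G Bx x).card := hmin x hx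
  have hd1 : 1 + (subtreesIn G Bx x).card ≤ (subtreesIn G (Bv ∪ Bw)ᶜ u).card := by
    rw [hd]
    exact Nat.le_mul_of_pos_left _ hd0
  rw [hp, hr]
  generalize (subtreesIn G Bv v).card = b at *
  generalize (subtreesIn G Bw w).card = c at *
  generalize (subtreesIn G (Bv ∪ Bw)ᶜ u).card = d at *
  generalize ∑ A ∈ subtreesIn G (Bv ∪ Bw)ᶜ u, A.card = r at *
  generalize ∑ A ∈ subtreesIn G Bw w, A.card = s at *
  have hbd : 1 + b ≤ d := by omega
  have hR : 2 * (r * (1 + c) + d * s) ≤ d * (1 + c) * (d + (1 + c)) := by nlinarith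
  have hM : (d + (1 + c)) * (1 + b) < 2 * (1 + d * (1 + c)) := by nlinarith
  have hpos : 0 < d * (1 + c) := Nat.mul_pos (by omega) (by omega)
  nlinarith [Nat.mul_le_mul_right (1 + b) hR, Nat.mul_lt_mul_of_pos_left hM hpos]
end

section
/- Let T be a finite tree, u and v adjacent vertices of T, let N(u)∖{v} = {u_1,...,u_k} and N(v)∖{u} = {v_1,...,v_s}, and for w in these sets let T_w be the component of T − {u,v} containing w. Writing α_i = φ_{T_{u_i},u_i}(1), β_i = φ_{T_{v_i},v_i}(1), α'_i = φ'_{T_{u_i},u_i}(1), β'_i = φ'_{T_{v_i},v_i}(1), and β = ∏_{i=1}^s (1+β_i), then μ(T;u) = [1 + Σ_{i=1}^k α'_i/(1+α_i) + 2β + β(Σ_{i=1}^k α'_i/(1+α_i) + Σ_{i=1}^s β'_i/(1+β_i))] / (1+β). -/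
open Finset Polynomial

variable {V : Type*}

/-- `φ_{T_w,w}(1)`: the number of subtrees of the component `T_w` of `T - {u,v}`
containing `w`, that contain `w`. -/
noncomputable def compCount [Fintype V] [DecidableEq V] (G : SimpleGraph V) (u v w : V) : ℝ :=
  ((subtreesIn G (compDel G {u, v} w) w).card : ℝ)

/-- `φ'_{T_w,w}(1)`: the total number of vertices, summed over all subtrees of the
component `T_w` of `T - {u,v}` containing `w`. -/
noncomputable def compTotal [Fintype V] [DecidableEq V] (G : SimpleGraph V) (u v w : V) : ℝ :=
  ∑ A ∈ subtreesIn G (compDel G {u, v} w) w, (A.card : ℝ)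

/-- The neighbours of `u` other than `v`, as a `Finset`. -/
noncomputable def nbrFinsetAvoid [Fintype V] (G : SimpleGraph V) (u v : V) : Finset V := by
  classical
  exact Finset.univ.filter fun w => G.Adj u w ∧ w ≠ v

theorem mem_subtreesIn_iff [Fintype V] [DecidableEq V] {G : SimpleGraph V} {S : Set V} {w : V}
    {A : Finset V} :
    A ∈ subtreesIn G S w ↔
      w ∈ A ∧ (A : Set V) ⊆ S ∧ ∀ x ∈ A, ∃ p : G.Walk x w, ∀ y ∈ p.support, y ∈ A := by
  classical
  simp only [subtreesIn, Finset.mem_filter, Finset.mem_univ, true_and]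
  refine and_congr_right fun hw => and_congr_right fun _ => ⟨fun h x hx => ?_, fun h => ?_⟩
  · obtain ⟨q⟩ := h.preconnected ⟨x, hx⟩ ⟨w, hw⟩
    let f := (SimpleGraph.Embedding.induce (G := G) (A : Set V)).toHom
    refine ⟨q.map f, fun y hy => ?_⟩
    have hy' : y ∈ (q.map f).support := hy
    rw [SimpleGraph.Walk.support_map, List.mem_map] at hy'
    obtain ⟨z, -, rfl⟩ := hy'
    exact z.2
  · refine SimpleGraph.induce_connected_of_patches w hw fun {x} hx => ?_
    obtain ⟨p, hp⟩ := h x hx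
    exact ⟨{y | y ∈ p.support}, hp, p.end_mem_support, p.start_mem_support,
      p.connected_induce_support.preconnected _ _⟩

theorem mem_compDel_of_mem_support {G : SimpleGraph V} {D : Set V} {w x y : V} (p : G.Walk x w)
    (hp : ∀ z ∈ p.support, z ∉ D) (hy : y ∈ p.support) : y ∈ compDel G D w := by
  classical
  refine ⟨(p.dropUntil y hy).reverse, fun z hz => hp z ?_⟩
  rw [SimpleGraph.Walk.support_reverse, List.mem_reverse] at hz
  exact p.support_dropUntil_subset_support hy hz

theorem notMem_of_mem_compDel {G : SimpleGraph V} {D : Set V} {w x : V}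
    (hx : x ∈ compDel G D w) : x ∉ D := by
  obtain ⟨p, hp⟩ := hx
  exact hp x p.end_mem_support

/-- A walk inside `A` from a vertex outside `D` to a vertex of `D` has an initial piece that
leads, outside `D`, to a neighbour of `A ∩ D`. -/
theorem exists_walk_to_neighbour {G : SimpleGraph V} {D A : Set V} {x c : V} (p : G.Walk x c)
    (hp : ∀ y ∈ p.support, y ∈ A) (hx : x ∉ D) (hc : c ∈ D) :
    ∃ w, w ∉ D ∧ (∃ r ∈ A ∩ D, G.Adj r w) ∧
      ∃ q : G.Walk x w, ∀ y ∈ q.support, y ∈ A ∧ y ∉ D := by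
  induction p with
  | nil => exact absurd hc hx
  | @cons x y _ h p ih =>
    have hxA : x ∈ A := hp x (by simp)
    have hp' : ∀ z ∈ p.support, z ∈ A := fun z hz => hp z (by simp [hz])
    by_cases hy : y ∈ D
    · exact ⟨x, hx, ⟨y, ⟨hp' y p.start_mem_support, hy⟩, h.symm⟩, .nil, by simp [hxA, hx]⟩
    · obtain ⟨w, hw, hr, q, hq⟩ := ih hp' hy hc
      refine ⟨w, hw, hr, .cons h q, fun z hz => ?_⟩
      rw [SimpleGraph.Walk.support_cons, List.mem_cons] at hz
      rcases hz with rfl | hz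
      exacts [⟨hxA, hx⟩, hq z hz]

/-- Generating polynomial of the subtrees meeting `D` exactly in `R`: they arise by gluing to `R`
an arbitrary, possibly empty, subtree rooted at each neighbour of `R` outside `D`. -/
theorem sum_subtrees_inter_eq [Fintype V] [DecidableEq V] (G : SimpleGraph V) {D : Set V}
    {R W : Finset V} {c : V} (hRD : (R : Set V) ⊆ D) (hcR : c ∈ R)
    (hR : ∀ x ∈ R, ∃ p : G.Walk x c, ∀ y ∈ p.support, y ∈ R)
    (hW : ∀ w, w ∈ W ↔ w ∉ D ∧ ∃ r ∈ R, G.Adj r w)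
    (hdisj : ∀ w ∈ W, ∀ w' ∈ W, ∀ x, x ∈ compDel G D w → x ∈ compDel G D w' → w = w')
    {F : Finset (Finset V)}
    (hF : ∀ A, A ∈ F ↔ A ∈ subtrees G c ∧ (A : Set V) ∩ D = R) :
    ∑ A ∈ F, (X : ℝ[X]) ^ A.card =
      X ^ R.card * ∏ w ∈ W, (1 + subtreePolyIn G (compDel G D w) w) := by
  classical
  have hfac : ∀ w, 1 + subtreePolyIn G (compDel G D w) w =
      ∑ B ∈ insert ∅ (subtreesIn G (compDel G D w) w), (X : ℝ[X]) ^ B.card := by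
    intro w
    rw [Finset.sum_insert (fun h => by simpa using (mem_subtreesIn_iff.1 h).1)]
    simp [subtreePolyIn]
  have hsub : ∀ p ∈ W.pi fun w => insert ∅ (subtreesIn G (compDel G D w) w),
      ∀ w (hw : w ∈ W), ∀ x ∈ p w hw, x ∈ compDel G D w := by
    intro p hp w hw x hx
    rcases Finset.mem_insert.1 (Finset.mem_pi.1 hp w hw) with h | h
    · simp [h] at hx
    · exact (mem_subtreesIn_iff.1 h).2.1 hx
  have hcover : ∀ A ∈ F, ∀ x ∈ A, x ∉ D → ∃ w ∈ W, w ∈ A ∧ x ∈ compDel G D w ∧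
      ∃ q : G.Walk x w, ∀ y ∈ q.support, y ∈ A ∧ y ∈ compDel G D w := by
    intro A hA x hx hxD
    obtain ⟨hA, hAD⟩ := (hF A).1 hA
    obtain ⟨p, hp⟩ := (mem_subtreesIn_iff.1 hA).2.2 x hx
    obtain ⟨w, hwD, hr, q, hq⟩ := exists_walk_to_neighbour (A := (A : Set V)) p hp hxD (hRD hcR)
    rw [hAD] at hr
    have hqc : ∀ y ∈ q.support, y ∈ compDel G D w := fun y hy =>
      mem_compDel_of_mem_support q (fun z hz => (hq z hz).2) hy
    exact ⟨w, (hW w).2 ⟨hwD, hr⟩, (hq w q.end_mem_support).1, hqc x q.start_mem_support,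
      q, fun y hy => ⟨(hq y hy).1, hqc y hy⟩⟩
  have hglueD : ∀ p ∈ W.pi fun w => insert ∅ (subtreesIn G (compDel G D w) w),
      ∀ x, x ∈ W.attach.biUnion (fun w => p w.1 w.2) → x ∉ D := by
    intro p hp x hx
    obtain ⟨w, -, hx⟩ := Finset.mem_biUnion.1 hx
    exact notMem_of_mem_compDel (hsub p hp w.1 w.2 x hx)
  simp_rw [hfac]
  rw [Finset.prod_sum, Finset.mul_sum]
  symm
  refine Finset.sum_bij' (fun p _ => R ∪ W.attach.biUnion fun w => p w.1 w.2)
    (fun A _ w _ => A.filter (· ∈ compDel G D w)) ?_ ?_ ?_ ?_ ?_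
  · intro p hp
    refine (hF _).2 ⟨mem_subtreesIn_iff.2 ⟨Finset.mem_union_left _ hcR, Set.subset_univ _, ?_⟩, ?_⟩
    · intro x hx
      rcases Finset.mem_union.1 hx with hx | hx
      · obtain ⟨q, hq⟩ := hR x hx
        exact ⟨q, fun y hy => Finset.mem_union_left _ (hq y hy)⟩
      · obtain ⟨w, -, hx⟩ := Finset.mem_biUnion.1 hx
        have hin : ∀ y ∈ p w.1 w.2, y ∈ R ∪ W.attach.biUnion fun w => p w.1 w.2 := fun y hy =>
          Finset.mem_union_right _ (Finset.mem_biUnion.2 ⟨w, Finset.mem_attach _ _, hy⟩)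
        have hpw : p w.1 w.2 ∈ subtreesIn G (compDel G D w.1) w.1 := by
          rcases Finset.mem_insert.1 (Finset.mem_pi.1 hp w.1 w.2) with h | h
          · simp [h] at hx
          · exact h
        obtain ⟨q, hq⟩ := (mem_subtreesIn_iff.1 hpw).2.2 x hx
        obtain ⟨-, r, hr, hrw⟩ := (hW w.1).1 w.2
        obtain ⟨q', hq'⟩ := hR r hr
        refine ⟨q.append (.cons hrw.symm q'), fun y hy => ?_⟩
        rw [SimpleGraph.Walk.mem_support_append_iff, SimpleGraph.Walk.support_cons,
          List.mem_cons] at hy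
        rcases hy with hy | rfl | hy
        exacts [hin y (hq y hy), hin _ (hq _ q.end_mem_support),
          Finset.mem_union_left _ (hq' y hy)]
    · ext x
      simp only [Set.mem_inter_iff, Finset.mem_coe, Finset.mem_union]
      exact ⟨fun h => h.1.resolve_right fun h' => hglueD p hp x h' h.2,
        fun h => ⟨Or.inl h, hRD h⟩⟩
  · intro A hA
    refine Finset.mem_pi.2 fun w hw => Finset.mem_insert.2 ?_
    rcases Finset.eq_empty_or_nonempty (A.filter (· ∈ compDel G D w)) with h | ⟨x, hx⟩
    · exact Or.inl h
    · have key : ∀ z ∈ A.filter (· ∈ compDel G D w), w ∈ A ∧ ∃ q : G.Walk z w,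
          ∀ y ∈ q.support, y ∈ A ∧ y ∈ compDel G D w := by
        intro z hz
        obtain ⟨hzA, hzw⟩ := Finset.mem_filter.1 hz
        obtain ⟨w', hw', hwA, hzw', q⟩ := hcover A hA z hzA (notMem_of_mem_compDel hzw)
        obtain rfl := hdisj w hw w' hw' z hzw hzw'
        exact ⟨hwA, q⟩
      obtain ⟨hwA, q, hq⟩ := key x hx
      refine Or.inr (mem_subtreesIn_iff.2
        ⟨Finset.mem_filter.2 (hq w q.end_mem_support), fun y hy => (Finset.mem_filter.1 hy).2, ?_⟩)
      intro z hz
      obtain ⟨-, q, hq⟩ := key z hz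
      exact ⟨q, fun y hy => Finset.mem_filter.2 (hq y hy)⟩
  · intro p hp
    funext w hw
    ext x
    simp only [Finset.mem_filter, Finset.mem_union, Finset.mem_biUnion]
    constructor
    · rintro ⟨hx | ⟨w', -, hx⟩, hxw⟩
      · exact absurd (hRD hx) (notMem_of_mem_compDel hxw)
      · obtain ⟨w', hw'⟩ := w'
        obtain rfl := hdisj w hw w' hw' x hxw (hsub p hp w' hw' x hx)
        exact hx
    · exact fun hx => ⟨Or.inr ⟨⟨w, hw⟩, Finset.mem_attach _ _, hx⟩, hsub p hp w hw x hx⟩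
  · intro A hA
    have hAD := ((hF A).1 hA).2
    ext x
    simp only [Finset.mem_union, Finset.mem_biUnion, Finset.mem_filter]
    constructor
    · rintro (hx | ⟨w, -, hx, -⟩)
      · exact (hAD.symm.subset hx).1
      · exact hx
    · intro hx
      by_cases hxD : x ∈ D
      · exact Or.inl (hAD.subset ⟨hx, hxD⟩)
      · obtain ⟨w, hw, -, hxw, -⟩ := hcover A hA x hx hxD
        exact Or.inr ⟨⟨w, hw⟩, Finset.mem_attach _ _, hx, hxw⟩
  · intro p hp
    rw [Finset.card_union_of_disjoint, Finset.card_biUnion, pow_add, Finset.prod_pow_eq_pow_sum]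
    · intro w _ w' _ hne
      refine Finset.disjoint_left.2 fun x hx hx' => hne (Subtype.ext ?_)
      exact hdisj w.1 w.2 w'.1 w'.2 x (hsub p hp _ _ x hx) (hsub p hp _ _ x hx')
    · exact Finset.disjoint_left.2 fun x hx hx' => hglueD p hp x hx' (hRD hx)

theorem SimpleGraph.IsTree.eq_of_mem_compDel {G : SimpleGraph V} (hG : G.IsTree) {u v : V}
    (huv : G.Adj u v) {w w' r r' x : V} (hr : r ∈ ({u, v} : Set V)) (hr' : r' ∈ ({u, v} : Set V))
    (hw : w ∉ ({u, v} : Set V)) (hw' : w' ∉ ({u, v} : Set V)) (hrw : G.Adj r w)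
    (hrw' : G.Adj r' w') (hx : x ∈ compDel G {u, v} w) (hx' : x ∈ compDel G {u, v} w') :
    w = w' := by
  classical
  by_contra hne
  obtain ⟨p, hp⟩ := hx
  obtain ⟨p', hp'⟩ := hx'
  have hpath : ∃ q : G.Walk w w', q.IsPath ∧ r ∈ q.support := by
    have hwr : w ≠ r := hrw.ne.symm
    have hrw'ne : r ≠ w' := fun h => hw' (h ▸ hr)
    by_cases hrr : r = r'
    · subst hrr
      exact ⟨.cons hrw.symm (.cons hrw' .nil), by
        simp [SimpleGraph.Walk.cons_isPath_iff, hwr, hne, hrw'ne], by simp⟩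
    · have hadj : G.Adj r r' := by
        simp only [Set.mem_insert_iff, Set.mem_singleton_iff] at hr hr'
        rcases hr with rfl | rfl <;> rcases hr' with rfl | rfl
        exacts [absurd rfl hrr, huv, huv.symm, absurd rfl hrr]
      have hwr' : w ≠ r' := fun h => hw (h ▸ hr')
      exact ⟨.cons hrw.symm (.cons hadj (.cons hrw' .nil)), by
        simp [SimpleGraph.Walk.cons_isPath_iff, hwr, hne, hrw'ne, hrr, hwr', hrw'.ne], by simp⟩
  obtain ⟨q, hq, hrq⟩ := hpath
  have heq := (hG.existsUnique_path w w').unique hq (p.append p'.reverse).bypass_isPath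
  rw [heq] at hrq
  have := (p.append p'.reverse).support_bypass_subset_support hrq
  rw [SimpleGraph.Walk.mem_support_append_iff, SimpleGraph.Walk.support_reverse,
    List.mem_reverse] at this
  exact this.elim (fun h => hp r h hr) fun h => hp' r h hr

theorem eval_derivative_prod_eq {ι : Type*} [DecidableEq ι] (s : Finset ι) (f : ι → ℝ[X]) (a : ℝ)
    (h : ∀ i ∈ s, (f i).eval a ≠ 0) :
    (derivative (∏ i ∈ s, f i)).eval a =
      (∏ i ∈ s, (f i).eval a) * ∑ i ∈ s, (derivative (f i)).eval a / (f i).eval a := by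
  rw [derivative_prod_finset, eval_finsetSum, Finset.mul_sum]
  refine Finset.sum_congr rfl fun i hi => ?_
  rw [eval_mul, eval_prod, ← Finset.mul_prod_erase s _ hi]
  field_simp [h i hi]

theorem eval_one_sum_X_pow (F : Finset (Finset V)) :
    (∑ A ∈ F, (X : ℝ[X]) ^ A.card).eval 1 = F.card := by
  simp [eval_finsetSum]

theorem eval_one_derivative_sum_X_pow (F : Finset (Finset V)) :
    (derivative (∑ A ∈ F, (X : ℝ[X]) ^ A.card)).eval 1 = ∑ A ∈ F, (A.card : ℝ) := by
  simp [eval_finsetSum, derivative_X_pow]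

theorem mem_nbrFinsetAvoid [Fintype V] {G : SimpleGraph V} {u v w : V} :
    w ∈ nbrFinsetAvoid G u v ↔ G.Adj u w ∧ w ≠ v := by
  simp [nbrFinsetAvoid]

/-- The generating polynomial of the subtrees containing an end `u` of an edge `uv` of a tree,
split according to whether they contain `v`. -/
theorem subtreePoly_eq_of_adj [Fintype V] [DecidableEq V] {G : SimpleGraph V} (hG : G.IsTree)
    {u v : V} (huv : G.Adj u v) :
    subtreePoly G u =
      X * (∏ w ∈ nbrFinsetAvoid G u v, (1 + subtreePolyIn G (compDel G {u, v} w) w)) *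
        (1 + X * ∏ w ∈ nbrFinsetAvoid G v u, (1 + subtreePolyIn G (compDel G {u, v} w) w)) := by
  classical
  have hdisj : Disjoint (nbrFinsetAvoid G u v) (nbrFinsetAvoid G v u) := by
    refine Finset.disjoint_left.2 fun w hw hw' => ?_
    rw [mem_nbrFinsetAvoid] at hw hw'
    have := (hG.existsUnique_path u v).unique
      (y₁ := .cons huv .nil) (y₂ := .cons hw.1 (.cons hw'.1.symm .nil))
      (by simp [SimpleGraph.Walk.cons_isPath_iff, huv.ne])
      (by simp [SimpleGraph.Walk.cons_isPath_iff, huv.ne, hw.2, hw'.2.symm])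
    simpa using congrArg SimpleGraph.Walk.length this
  have hsep : ∀ w w', w ∉ ({u, v} : Set V) → (∃ r ∈ ({u, v} : Set V), G.Adj r w) →
      w' ∉ ({u, v} : Set V) → (∃ r ∈ ({u, v} : Set V), G.Adj r w') →
      ∀ x, x ∈ compDel G {u, v} w → x ∈ compDel G {u, v} w' → w = w' := by
    rintro w w' hw ⟨r, hr, hrw⟩ hw' ⟨r', hr', hrw'⟩ x hx hx'
    exact hG.eq_of_mem_compDel huv hr hr' hw hw' hrw hrw' hx hx'
  have hu : ∀ w, w ∈ nbrFinsetAvoid G u v ↔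
      w ∉ ({u, v} : Set V) ∧ ∃ r ∈ ({u} : Finset V), G.Adj r w := by
    intro w
    have : G.Adj u w → w ≠ u := fun h => h.ne.symm
    simp only [mem_nbrFinsetAvoid, Set.mem_insert_iff, Set.mem_singleton_iff,
      Finset.mem_singleton, exists_eq_left]
    tauto
  have huv' : ∀ w, w ∈ nbrFinsetAvoid G u v ∪ nbrFinsetAvoid G v u ↔
      w ∉ ({u, v} : Set V) ∧ ∃ r ∈ ({u, v} : Finset V), G.Adj r w := by
    intro w
    have h1 : G.Adj u w → w ≠ u := fun h => h.ne.symm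
    have h2 : G.Adj v w → w ≠ v := fun h => h.ne.symm
    simp only [mem_nbrFinsetAvoid, Finset.mem_union, Set.mem_insert_iff, Set.mem_singleton_iff,
      Finset.mem_insert, Finset.mem_singleton, exists_eq_or_imp, exists_eq_left]
    tauto
  have hmem : ∀ A ∈ subtrees G u, u ∈ A := fun A hA => (mem_subtreesIn_iff.1 hA).1
  have h1 := sum_subtrees_inter_eq G (D := {u, v}) (R := {u}) (c := u)
    (W := nbrFinsetAvoid G u v) (F := (subtrees G u).filter fun A => v ∉ A)
    (by simp) (by simp)
    (by
      intro x hx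
      obtain rfl := Finset.mem_singleton.1 hx
      exact ⟨.nil, by simp⟩) hu
    (fun w hw w' hw' => by
      obtain ⟨hw, r, hr, hrw⟩ := (hu w).1 hw
      obtain ⟨hw', r', hr', hrw'⟩ := (hu w').1 hw'
      exact hsep w w' hw ⟨r, by simp_all, hrw⟩ hw' ⟨r', by simp_all, hrw'⟩)
    (fun A => by
      rw [Finset.mem_filter]
      refine and_congr_right fun hA => ?_
      have := hmem A hA
      constructor
      · intro hv
        ext x
        simp only [Set.mem_inter_iff, Finset.mem_coe, Set.mem_insert_iff, Set.mem_singleton_iff,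
          Finset.mem_singleton]
        constructor
        · rintro ⟨hx, rfl | rfl⟩
          exacts [rfl, absurd hx hv]
        · rintro rfl
          exact ⟨this, Or.inl rfl⟩
      · intro h hv
        have hvu : v ∈ (({u} : Finset V) : Set V) := h ▸ ⟨hv, by simp⟩
        exact huv.ne' (by simpa using hvu))
  have h2 := sum_subtrees_inter_eq G (D := {u, v}) (R := {u, v}) (c := u)
    (W := nbrFinsetAvoid G u v ∪ nbrFinsetAvoid G v u)
    (F := (subtrees G u).filter fun A => ¬ v ∉ A)
    (by simp) (by simp)
    (by
      intro x hx
      rcases Finset.mem_insert.1 hx with rfl | hx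
      · exact ⟨.nil, by simp⟩
      · obtain rfl := Finset.mem_singleton.1 hx
        exact ⟨.cons huv.symm .nil, by simp⟩) huv'
    (fun w hw w' hw' => by
      obtain ⟨hw, r, hr, hrw⟩ := (huv' w).1 hw
      obtain ⟨hw', r', hr', hrw'⟩ := (huv' w').1 hw'
      exact hsep w w' hw ⟨r, by simpa using hr, hrw⟩ hw' ⟨r', by simpa using hr', hrw'⟩)
    (fun A => by
      rw [Finset.mem_filter, not_not]
      refine and_congr_right fun hA => ?_
      have := hmem A hA
      rw [Finset.coe_pair, Set.inter_eq_right]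
      simp [Set.insert_subset_iff, this])
  rw [Finset.prod_union hdisj, Finset.card_pair huv.ne] at h2
  have h3 := Finset.sum_filter_add_sum_filter_not (subtrees G u) (fun A => v ∉ A)
    fun A => (X : ℝ[X]) ^ A.card
  rw [h1, h2, Finset.card_singleton] at h3
  change ∑ A ∈ subtrees G u, _ = _
  rw [← h3]
  ring

/-- For adjacent vertices `u, v` of a tree `T`, with
`α_w = φ_{T_w,w}(1)`, `α'_w = φ'_{T_w,w}(1)` for the components `T_w` of `T - {u,v}` and
`β = ∏_{w ∈ N(v)∖{u}} (1 + α_w)`: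
`μ(T;u) = (1 + Σ_{w ∈ N(u)∖{v}} α'_w/(1+α_w) + 2β
  + β(Σ_{w ∈ N(u)∖{v}} α'_w/(1+α_w) + Σ_{w ∈ N(v)∖{u}} α'_w/(1+α_w))) / (1+β)`. -/
theorem meanOrder_formula {V : Type*} [Fintype V] [DecidableEq V]
    (G : SimpleGraph V) (hG : G.IsTree) (u v : V) (huv : G.Adj u v) :
    meanOrder G u =
      (1 + (∑ w ∈ nbrFinsetAvoid G u v, compTotal G u v w / (1 + compCount G u v w))
        + 2 * (∏ w ∈ nbrFinsetAvoid G v u, (1 + compCount G u v w))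
        + (∏ w ∈ nbrFinsetAvoid G v u, (1 + compCount G u v w)) *
            ((∑ w ∈ nbrFinsetAvoid G u v, compTotal G u v w / (1 + compCount G u v w)) +
              (∑ w ∈ nbrFinsetAvoid G v u, compTotal G u v w / (1 + compCount G u v w))))
      / (1 + ∏ w ∈ nbrFinsetAvoid G v u, (1 + compCount G u v w)) := by
  have hpos : ∀ w, (0 : ℝ) < 1 + compCount G u v w := fun w =>
    add_pos_of_pos_of_nonneg one_pos (Nat.cast_nonneg _)
  have hev : ∀ w, (1 + subtreePolyIn G (compDel G {u, v} w) w).eval 1 = 1 + compCount G u v w :=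
    fun w => by rw [eval_add, eval_one, subtreePolyIn, eval_one_sum_X_pow, compCount]
  have hev' : ∀ w, (derivative (1 + subtreePolyIn G (compDel G {u, v} w) w)).eval 1 =
      compTotal G u v w := fun w => by
    rw [derivative_add, derivative_one, zero_add, subtreePolyIn, eval_one_derivative_sum_X_pow,
      compTotal]
  have hprod : ∀ s : Finset V,
      (∏ w ∈ s, (1 + subtreePolyIn G (compDel G {u, v} w) w)).eval 1 =
        ∏ w ∈ s, (1 + compCount G u v w) := fun s => by simp_rw [eval_prod, hev]
  have hprod' : ∀ s : Finset V,
      (derivative (∏ w ∈ s, (1 + subtreePolyIn G (compDel G {u, v} w) w))).eval 1 =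
        (∏ w ∈ s, (1 + compCount G u v w)) *
          ∑ w ∈ s, compTotal G u v w / (1 + compCount G u v w) := fun s => by
    rw [eval_derivative_prod_eq s _ 1 fun w _ => by rw [hev]; exact (hpos w).ne']
    simp_rw [hev, hev']
  have hP : 0 < ∏ w ∈ nbrFinsetAvoid G u v, (1 + compCount G u v w) :=
    Finset.prod_pos fun w _ => hpos w
  have hQ : 0 < ∏ w ∈ nbrFinsetAvoid G v u, (1 + compCount G u v w) :=
    Finset.prod_pos fun w _ => hpos w
  have hpoly : ∑ A ∈ subtrees G u, (X : ℝ[X]) ^ A.card = _ := subtreePoly_eq_of_adj hG huv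
  rw [meanOrder, ← eval_one_sum_X_pow, ← eval_one_derivative_sum_X_pow, hpoly]
  simp only [derivative_mul, derivative_add, derivative_one, derivative_X, eval_add, eval_mul,
    eval_one, eval_X, hprod, hprod', zero_add, one_mul]
  rw [div_eq_div_iff (by positivity) (by positivity)]
  ring
end

section
/- For any k-tree T (k ≥ 1) and any k-clique C of T, the local mean order of sub-k-trees of T containing C satisfies μ(T; C) = μ(T'_C; C) + k − 1, where T'_C is the characteristic 1-tree of T with respect to C. -/
open Finset Polynomial

variable {V : Type*}

/-- `IsKTreeOn G k s` : the induced subgraph of `G` on the vertex set `s` is a `k`-tree,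
following the recursive definition: `K_k` is a `k`-tree, and a `k`-tree grows by adding a
new vertex adjacent exactly to the vertices of some `k`-clique. -/
inductive IsKTreeOn [DecidableEq V] (G : SimpleGraph V) (k : ℕ) : Finset V → Prop
  | base (s : Finset V) : G.IsNClique k s → IsKTreeOn G k s
  | grow (s : Finset V) (v : V) (C : Finset V) :
      IsKTreeOn G k s → v ∉ s → C ⊆ s → G.IsNClique k C →
      (∀ w ∈ s, G.Adj v w ↔ w ∈ C) → IsKTreeOn G k (insert v s)

/-- `G` is a `k`-tree. -/
def IsKTree [Fintype V] [DecidableEq V] (G : SimpleGraph V) (k : ℕ) : Prop :=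
  IsKTreeOn G k Finset.univ

/-- The vertex sets of the sub-`k`-trees of `G` containing the `k`-clique `C`. -/
noncomputable def subKTrees [Fintype V] [DecidableEq V] (G : SimpleGraph V) (k : ℕ)
    (C : Finset V) : Finset (Finset V) := by
  classical
  exact Finset.univ.filter fun A => C ⊆ A ∧ IsKTreeOn G k A

/-- The local mean order `μ(T; C)`: the average order of the sub-`k`-trees of `G`
containing the `k`-clique `C`. -/
noncomputable def kMean [Fintype V] [DecidableEq V] (G : SimpleGraph V) (k : ℕ)
    (C : Finset V) : ℝ :=
  (∑ A ∈ subKTrees G k C, (A.card : ℝ)) / ((subKTrees G k C).card : ℝ)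

/-- The degree of a `k`-clique `C` in `G`: the number of `(k+1)`-cliques of `G`
containing `C`. -/
noncomputable def cliqueDeg [Fintype V] [DecidableEq V] (G : SimpleGraph V) (k : ℕ)
    (C : Finset V) : ℕ := by
  classical
  exact (Finset.univ.filter fun Q : Finset V => C ⊆ Q ∧ G.IsNClique (k + 1) Q).card

/-- Two (distinct) `k`-cliques are adjacent if they are contained in a common
`(k+1)`-clique. -/
def CliqueAdj (G : SimpleGraph V) (k : ℕ) (C₁ C₂ : Finset V) : Prop :=
  C₁ ≠ C₂ ∧ ∃ Q : Finset V, G.IsNClique (k + 1) Q ∧ C₁ ⊆ Q ∧ C₂ ⊆ Q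

/-- `IsPathTypeOn G k s` : the induced subgraph of `G` on `s` is a path-type `k`-tree:
`K_k` and `K_{k+1}` are path-type, and a path-type `k`-tree of order `≥ k+1` grows by
joining a new vertex to a simplicial `k`-clique (a `k`-clique containing a vertex of
degree `k`). -/
inductive IsPathTypeOn [DecidableEq V] (G : SimpleGraph V) (k : ℕ) : Finset V → Prop
  | base₁ (s : Finset V) : G.IsNClique k s → IsPathTypeOn G k s
  | base₂ (s : Finset V) : G.IsNClique (k + 1) s → IsPathTypeOn G k s
  | grow (s : Finset V) (v : V) (C : Finset V) :
      IsPathTypeOn G k s → k + 1 ≤ s.card → v ∉ s → C ⊆ s → G.IsNClique k C →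
      (∃ ℓ ∈ C, (G.neighborSet ℓ ∩ (↑s : Set V)).ncard = k) →
      (∀ w ∈ s, G.Adj v w ↔ w ∈ C) → IsPathTypeOn G k (insert v s)

/-- `IsPEO G k C L` : the reverse of the list `L = [w₁, …, w_s, v]` is a perfect
elimination ordering of the induced subgraph on `C ∪ L` down to `C`: each vertex, from
the last one backwards, is a `k`-leaf (degree exactly `k`) of the graph induced on `C`
together with the not-yet-eliminated vertices. -/
inductive IsPEO [DecidableEq V] (G : SimpleGraph V) (k : ℕ) (C : Finset V) : List V → Prop
  | nil : IsPEO G k C []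
  | snoc (l : List V) (v : V) : IsPEO G k C l → v ∉ C → v ∉ l →
      (G.neighborSet v ∩ ((↑C : Set V) ∪ {x | x ∈ l})).ncard = k →
      IsPEO G k C (l ++ [v])

/-- `IsCanonPath G k C L` : the list `L = [w₁, …, w_s, v]` records the unique sequence
`A_T(C, v)` of Stephens–Oellermann: the induced subgraph on `C ∪ L` is a path-type
`k`-tree having `C` as a simplicial `k`-clique, and `(v, w_s, …, w₁)` is a perfect
elimination ordering of it down to `C`. -/
def IsCanonPath [Fintype V] [DecidableEq V] (G : SimpleGraph V) (k : ℕ) (C : Finset V)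
    (L : List V) : Prop :=
  L ≠ [] ∧ L.Nodup ∧ (∀ x ∈ L, x ∉ C) ∧
    IsPathTypeOn G k (C ∪ L.toFinset) ∧
    (∃ ℓ ∈ C, (G.neighborSet ℓ ∩ ((↑C : Set V) ∪ {x | x ∈ L})).ncard = k) ∧
    IsPEO G k C L

/-- The characteristic `1`-tree `T'_C` of the `k`-tree `G` with respect to the `k`-clique
`C`.  Its vertices are the vertices of `G` outside `C` together with one extra vertex
`none` representing `C`; its edges are the union, over all `k`-leaves `v` of `G` outside
`C`, of the paths `C – w₁ – ⋯ – w_s – v` given by the canonical sequences `A_T(C, v)`. -/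
def charTree [Fintype V] [DecidableEq V] (G : SimpleGraph V) (k : ℕ) (C : Finset V) :
    SimpleGraph (Option {x : V // x ∉ C}) :=
  SimpleGraph.fromRel fun a b =>
    ∃ L : List V, IsCanonPath G k C L ∧
      (∃ v, L.getLast? = some v ∧ (G.neighborSet v).ncard = k) ∧
      ((a = none ∧ ∃ y : {x : V // x ∉ C}, b = some y ∧ L.head? = some y.val) ∨
        (∃ x y : {x : V // x ∉ C}, a = some x ∧ b = some y ∧ [x.val, y.val] <:+: L))

section NeighborsWithin

variable {G : SimpleGraph V} {s t : Finset V} {u v w : V} {n : ℕ}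

/-- The neighbours of `v` inside the finite set `s`. -/
noncomputable def nbrIn (G : SimpleGraph V) (s : Finset V) (v : V) : Finset V := by
  classical
  exact s.filter (G.Adj v)

@[simp]
lemma mem_nbrIn : w ∈ nbrIn G s v ↔ w ∈ s ∧ G.Adj v w := by
  simp [nbrIn]

lemma ncard_neighborSet_inter (S : Set V) (hS : S = s) :
    (G.neighborSet v ∩ S).ncard = (nbrIn G s v).card := by
  rw [← Set.ncard_coe_finset]
  congr 1
  ext w
  simp [hS, and_comm]

lemma nbrIn_mono (h : s ⊆ t) : nbrIn G s v ⊆ nbrIn G t v := fun w hw => by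
  rw [mem_nbrIn] at hw ⊢
  exact ⟨h hw.1, hw.2⟩

variable [DecidableEq V]

lemma nbrIn_insert_of_not_adj (h : ¬ G.Adj v u) : nbrIn G (insert u s) v = nbrIn G s v := by
  ext w
  simp only [mem_nbrIn, mem_insert]
  constructor
  · rintro ⟨rfl | hw, h'⟩
    · exact absurd h' h
    · exact ⟨hw, h'⟩
  · exact fun h' => ⟨Or.inr h'.1, h'.2⟩

lemma card_nbrIn_insert_of_adj (h : G.Adj v u) (hu : u ∉ s) :
    (nbrIn G (insert u s) v).card = (nbrIn G s v).card + 1 := by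
  rw [← card_insert_of_notMem (a := u) (s := nbrIn G s v) (by simp [hu])]
  congr 1
  ext w
  simp only [mem_nbrIn, mem_insert]
  constructor
  · rintro ⟨rfl | hw, h'⟩
    · exact Or.inl rfl
    · exact Or.inr ⟨hw, h'⟩
  · rintro (rfl | h')
    · exact ⟨Or.inl rfl, h⟩
    · exact ⟨Or.inr h'.1, h'.2⟩

lemma nbrIn_of_isClique (hs : G.IsClique (s : Set V)) (hv : v ∈ s) :
    nbrIn G s v = s.erase v := by
  ext w
  simp only [mem_nbrIn, mem_erase]
  exact ⟨fun h => ⟨h.2.ne', h.1⟩, fun h => ⟨h.2, hs hv h.2 (Ne.symm h.1)⟩⟩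

lemma card_nbrIn_of_isNClique (hs : G.IsNClique (n + 1) s) (hv : v ∈ s) :
    (nbrIn G s v).card = n := by
  rw [nbrIn_of_isClique hs.isClique hv, card_erase_of_mem hv, hs.card_eq, Nat.add_sub_cancel]

lemma union_concat_toFinset (C : Finset V) (l : List V) (v : V) :
    C ∪ (l ++ [v]).toFinset = insert v (C ∪ l.toFinset) := by
  ext x
  simp only [mem_union, mem_insert, List.mem_toFinset, List.mem_append, List.mem_singleton]
  tauto

lemma ncard_neighborSet_inter_union (C : Finset V) (l : List V) (v : V) :
    (G.neighborSet v ∩ ((C : Set V) ∪ {x | x ∈ l})).ncard =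
      (nbrIn G (C ∪ l.toFinset) v).card :=
  ncard_neighborSet_inter _ (by ext; simp)

end NeighborsWithin

section KTrees

variable [DecidableEq V] {G : SimpleGraph V} {k : ℕ} {s C : Finset V} {v : V}

lemma nbrIn_insert_self {Q : Finset V} (hQs : Q ⊆ s) (hadj : ∀ w ∈ s, G.Adj v w ↔ w ∈ Q) :
    nbrIn G (insert v s) v = Q := by
  rw [nbrIn_insert_of_not_adj (G.loopless.irrefl v)]
  ext w
  rw [mem_nbrIn]
  exact ⟨fun h => (hadj w h.1).1 h.2, fun h => ⟨hQs h, (hadj w (hQs h)).2 h⟩⟩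

lemma IsKTreeOn.le_card (h : IsKTreeOn G k s) : k ≤ s.card := by
  induction h with
  | base s hs => exact hs.card_eq.ge
  | grow s v C _ hv _ _ _ ih => rw [card_insert_of_notMem hv]; omega

lemma IsKTreeOn.isNClique (h : IsKTreeOn G k s) (hs : s.card = k) : G.IsNClique k s := by
  cases h with
  | base _ h => exact h
  | grow s v C h hv =>
    have := h.le_card
    rw [card_insert_of_notMem hv] at hs
    omega

/-- Induction for `k`-trees of order at least `k + 1`, starting from `K_{k+1}`. -/
lemma IsKTreeOn.induction_succ {P : Finset V → Prop}
    (base : ∀ s, G.IsNClique (k + 1) s → P s)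
    (grow : ∀ s v Q, IsKTreeOn G k s → k < s.card → P s → v ∉ s → Q ⊆ s → G.IsNClique k Q →
      (∀ w ∈ s, G.Adj v w ↔ w ∈ Q) → P (insert v s))
    (h : IsKTreeOn G k s) (hs : k < s.card) : P s := by
  induction h with
  | base s h => exact absurd h.card_eq hs.ne'
  | grow s v Q h hv hQs hQ hadj ih =>
    rcases h.le_card.lt_or_eq with hk | hk
    · exact grow s v Q h hk (ih hk) hv hQs hQ hadj
    · obtain rfl : Q = s := eq_of_subset_of_card_le hQs (by rw [hQ.card_eq, hk])
      exact base _ (hQ.insert fun w hw => (hadj w hw).2 hw)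

lemma IsKTreeOn.le_card_nbrIn (h : IsKTreeOn G k s) (hs : k < s.card) (hv : v ∈ s) :
    k ≤ (nbrIn G s v).card := by
  revert v
  refine IsKTreeOn.induction_succ
    (P := fun s => ∀ {v}, v ∈ s → k ≤ (nbrIn G s v).card) ?_ ?_ h hs
  · intro s hs v hv
    exact (card_nbrIn_of_isNClique hs hv).ge
  · intro s u Q _ _ ih _ hQs hQ hadj v hv
    rcases mem_insert.1 hv with rfl | hv
    · rw [nbrIn_insert_self hQs hadj, hQ.card_eq]
    · exact (ih hv).trans (card_le_card (nbrIn_mono (subset_insert _ _)))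

lemma IsKTreeOn.not_adj_of_card_nbrIn_insert {u : V} (h : IsKTreeOn G k s) (hs : k < s.card)
    (hu : u ∉ s) (hv : v ∈ s) (hd : (nbrIn G (insert u s) v).card = k) : ¬ G.Adj v u := by
  intro hvu
  have := h.le_card_nbrIn hs hv
  rw [card_nbrIn_insert_of_adj hvu hu] at hd
  omega

lemma IsKTreeOn.erase_leaf (h : IsKTreeOn G k s) (hs : k < s.card) (hv : v ∈ s)
    (hd : (nbrIn G s v).card = k) :
    IsKTreeOn G k (s.erase v) ∧ G.IsNClique k (nbrIn G s v) := by
  revert v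
  refine IsKTreeOn.induction_succ (P := fun s => ∀ {v}, v ∈ s → (nbrIn G s v).card = k →
    IsKTreeOn G k (s.erase v) ∧ G.IsNClique k (nbrIn G s v)) ?_ ?_ h hs
  · intro s hs v hv hd
    have key : G.IsNClique k (s.erase v) := by
      refine ⟨hs.isClique.subset (by simp), ?_⟩
      rw [← nbrIn_of_isClique hs.isClique hv, hd]
    exact ⟨.base _ key, by rwa [nbrIn_of_isClique hs.isClique hv]⟩
  · intro s u Q hT hk ih hu hQs hQ hadj v hv hd
    rcases mem_insert.1 hv with rfl | hv
    · rw [erase_insert hu, nbrIn_insert_self hQs hadj]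
      exact ⟨hT, hQ⟩
    · have hvu := hT.not_adj_of_card_nbrIn_insert hk hu hv hd
      rw [nbrIn_insert_of_not_adj hvu] at hd ⊢
      obtain ⟨h1, h2⟩ := ih hv hd
      refine ⟨?_, h2⟩
      have hne : u ≠ v := fun h => hu (h ▸ hv)
      rw [erase_insert_of_ne hne]
      refine .grow _ _ Q h1 (fun h => hu (mem_of_mem_erase h)) (fun w hw => ?_) hQ
        fun w hw => hadj w (mem_of_mem_erase hw)
      refine mem_erase.2 ⟨?_, hQs hw⟩
      rintro rfl
      exact hvu ((hadj w hv).2 hw).symm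

lemma IsKTreeOn.exists_leaf_notMem (h : IsKTreeOn G k s) (hs : k < s.card) (hCs : C ⊆ s)
    (hC : G.IsNClique k C) : ∃ v ∈ s, v ∉ C ∧ (nbrIn G s v).card = k := by
  revert C
  refine IsKTreeOn.induction_succ (P := fun s => ∀ {C}, C ⊆ s → G.IsNClique k C →
    ∃ v ∈ s, v ∉ C ∧ (nbrIn G s v).card = k) ?_ ?_ h hs
  · intro s hs C _ hC
    obtain ⟨v, hv, hvC⟩ := exists_mem_notMem_of_card_lt_card
      (s := C) (t := s) (by rw [hC.card_eq, hs.card_eq]; omega)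
    exact ⟨v, hv, hvC, card_nbrIn_of_isNClique hs hv⟩
  · intro s u Q hT hk ih hu hQs hQ hadj C hCs hC
    by_cases huC : u ∈ C
    · obtain ⟨v, hv, hvQ, hd⟩ := ih hQs hQ
      have hvu : ¬ G.Adj v u := fun h => hvQ ((hadj v hv).1 h.symm)
      refine ⟨v, mem_insert_of_mem hv, fun hvC => hvu (hC.isClique hvC huC ?_), ?_⟩
      · rintro rfl
        exact hu hv
      · rwa [nbrIn_insert_of_not_adj hvu]
    · exact ⟨u, mem_insert_self _ _, huC, by rw [nbrIn_insert_self hQs hadj, hQ.card_eq]⟩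

lemma IsKTreeOn.not_adj_of_leaves {u : V} (h : IsKTreeOn G k s) (hs : k + 2 ≤ s.card)
    (hu : u ∈ s) (hv : v ∈ s) (hdu : (nbrIn G s u).card = k) (hdv : (nbrIn G s v).card = k) :
    ¬ G.Adj v u := by
  intro hvu
  refine (h.erase_leaf (by omega) hu hdu).1.not_adj_of_card_nbrIn_insert ?_ (notMem_erase _ _)
    (mem_erase.2 ⟨hvu.ne, hv⟩) (by rwa [insert_erase hu]) hvu
  rw [card_erase_of_mem hu]
  omega

lemma IsPathTypeOn.isKTreeOn (h : IsPathTypeOn G k s) : IsKTreeOn G k s := by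
  induction h with
  | base₁ s hs => exact .base s hs
  | base₂ s hs =>
    obtain ⟨v, hv⟩ : s.Nonempty := card_pos.1 (by rw [hs.card_eq]; omega)
    have hQ : G.IsNClique k (s.erase v) :=
      ⟨hs.isClique.subset (by simp), by rw [card_erase_of_mem hv, hs.card_eq]; rfl⟩
    rw [← insert_erase hv]
    exact .grow _ v _ (.base _ hQ) (notMem_erase _ _) subset_rfl hQ fun w hw =>
      ⟨fun _ => hw, fun _ => hs.isClique hv (mem_of_mem_erase hw) (ne_of_mem_erase hw).symm⟩
  | grow s v C _ _ hv hCs hC _ hadj ih => exact .grow s v C ih hv hCs hC hadj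

/-- A path-type `k`-tree of order at least `k + 2` has at most two `k`-leaves. -/
lemma IsPathTypeOn.exists_leaves_subset_pair (h : IsPathTypeOn G k s) (hs : k + 2 ≤ s.card) :
    ∃ x y, ∀ a ∈ s, (nbrIn G s a).card = k → a = x ∨ a = y := by
  induction h with
  | base₁ s h => have := h.card_eq; omega
  | base₂ s h => have := h.card_eq; omega
  | grow s v Q h hk hv hQs hQ hℓ hadj ih =>
    obtain ⟨ℓ, hℓQ, hℓd⟩ := hℓ
    rw [ncard_neighborSet_inter _ rfl] at hℓd
    have hnot : ∀ a ∈ s, (nbrIn G (insert v s) a).card = k →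
        a ∉ Q ∧ (nbrIn G s a).card = k := by
      intro a ha hd
      have hav := h.isKTreeOn.not_adj_of_card_nbrIn_insert (by omega) hv ha hd
      rw [nbrIn_insert_of_not_adj hav] at hd
      exact ⟨fun haQ => hav ((hadj a ha).2 haQ).symm, hd⟩
    suffices H : ∃ y, ∀ a ∈ s, a ∉ Q → (nbrIn G s a).card = k → a = y by
      obtain ⟨y, hy⟩ := H
      refine ⟨v, y, fun a ha hd => ?_⟩
      rcases mem_insert.1 ha with rfl | ha
      · exact Or.inl rfl
      · exact Or.inr (hy a ha (hnot a ha hd).1 (hnot a ha hd).2)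
    rcases hk.lt_or_eq with hk | hk
    · obtain ⟨x, y, hxy⟩ := ih hk
      rcases hxy ℓ (hQs hℓQ) hℓd with rfl | rfl
      · exact ⟨y, fun a ha haQ hd => (hxy a ha hd).resolve_left (by rintro rfl; exact haQ hℓQ)⟩
      · exact ⟨x, fun a ha haQ hd => (hxy a ha hd).resolve_right (by rintro rfl; exact haQ hℓQ)⟩
    · have : (s \ Q).card = 1 := by
        rw [card_sdiff_of_subset hQs, hQ.card_eq]
        omega
      obtain ⟨y, hy⟩ := card_eq_one.1 this
      exact ⟨y, fun a ha haQ _ => mem_singleton.1 (hy ▸ mem_sdiff.2 ⟨ha, haQ⟩)⟩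

end KTrees

section Elimination

variable {G : SimpleGraph V} {k : ℕ} {A C S : Finset V} {r : V → ℕ} {u v w : V}

/-- The neighbours of `v` inside `S` of smaller rank. -/
noncomputable def backNbr (G : SimpleGraph V) (r : V → ℕ) (S : Finset V) (v : V) : Finset V :=
  (nbrIn G S v).filter (r · < r v)

@[simp]
lemma mem_backNbr :
    w ∈ backNbr G r S v ↔ w ∈ S ∧ G.Adj v w ∧ r w < r v := by
  simp [backNbr, and_assoc]

/-- The reverse of `r` is a perfect elimination ordering of the `k`-tree induced on `S` down to
the `k`-clique `C`, whose vertices are exactly those of rank `0`. -/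
structure IsElimRank (G : SimpleGraph V) (k : ℕ) (C S : Finset V) (r : V → ℕ) : Prop where
  eq_zero_iff : ∀ v ∈ S, r v = 0 ↔ v ∈ C
  eq_of_eq : ∀ u ∈ S, ∀ v ∈ S, u ∉ C → r u = r v → u = v
  isNClique : ∀ v ∈ S, v ∉ C → G.IsNClique k (backNbr G r S v)

namespace IsElimRank

lemma pos (hr : IsElimRank G k C S r) (hv : v ∈ S) (hvC : v ∉ C) : 0 < r v :=
  Nat.pos_of_ne_zero fun h => hvC ((hr.eq_zero_iff v hv).1 h)

lemma lt_of_mem (hr : IsElimRank G k C S r) (hw : w ∈ S) (hwC : w ∈ C) (hv : v ∈ S)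
    (hvC : v ∉ C) : r w < r v := by
  rw [(hr.eq_zero_iff w hw).2 hwC]
  exact hr.pos hv hvC

lemma notMem_of_mem_backNbr (hr : IsElimRank G k C S r) (hv : v ∈ S)
    (hw : w ∈ backNbr G r S v) : v ∉ C := fun hvC => by
  rw [mem_backNbr, (hr.eq_zero_iff v hv).2 hvC] at hw
  omega

end IsElimRank

variable [DecidableEq V]

/-- A `k`-tree can be built starting from any of its `k`-cliques. -/
lemma IsKTreeOn.exists_isElimRank (h : IsKTreeOn G k S) (hCS : C ⊆ S)
    (hC : G.IsNClique k C) : ∃ r, IsElimRank G k C S r := by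
  induction hn : S.card generalizing S with
  | zero =>
    obtain rfl := card_eq_zero.1 hn
    exact ⟨0, by simp, by simp, by simp⟩
  | succ n ih =>
    rcases h.le_card.lt_or_eq with hk | hk
    · obtain ⟨v, hv, hvC, hd⟩ := h.exists_leaf_notMem hk hCS hC
      obtain ⟨hT, hQ⟩ := h.erase_leaf hk hv hd
      obtain ⟨r, h0, hinj, hcl⟩ := ih hT (subset_erase.2 ⟨hCS, hvC⟩)
        (by rw [card_erase_of_mem hv, hn]; rfl)
      obtain ⟨m, hm0, hm⟩ : ∃ m, 0 < m ∧ ∀ w ∈ S, r w < m :=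
        ⟨S.sup r + 1, by omega, fun w hw => Nat.lt_succ_of_le (le_sup hw)⟩
      set r' := Function.update r v m with hr'
      have hv' : r' v = m := by simp [hr']
      have hne : ∀ w, w ≠ v → r' w = r w := fun w hw => by simp [hr', hw]
      refine ⟨r', fun w hw => ?_, fun u hu w hw huC huw => ?_, fun w hw hwC => ?_⟩
      · rcases eq_or_ne w v with rfl | hwv
        · rw [hv']
          exact ⟨fun h => absurd h hm0.ne', fun h => absurd h hvC⟩
        · rw [hne w hwv]
          exact h0 w (mem_erase.2 ⟨hwv, hw⟩)
      · by_cases huv : u = v <;> by_cases hwv : w = v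
        · rw [huv, hwv]
        · rw [huv, hv', hne w hwv] at huw
          exact absurd huw (hm w hw).ne'
        · rw [hwv, hv', hne u huv] at huw
          exact absurd huw (hm u hu).ne
        · rw [hne u huv, hne w hwv] at huw
          exact hinj u (mem_erase.2 ⟨huv, hu⟩) w (mem_erase.2 ⟨hwv, hw⟩) huC huw
      · rcases eq_or_ne w v with rfl | hwv
        · convert hQ using 1
          ext x
          simp only [mem_backNbr, mem_nbrIn, hv', and_congr_right_iff, and_iff_left_iff_imp]
          intro hx hadj
          rw [hne x hadj.ne']
          exact hm x hx
        · convert hcl w (mem_erase.2 ⟨hwv, hw⟩) hwC using 1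
          ext x
          simp only [mem_backNbr, hne w hwv, mem_erase]
          rcases eq_or_ne x v with rfl | hxv
          · simp [hv', (hm w hw).le]
          · simp [hne x hxv, hxv]
    · obtain rfl := eq_of_subset_of_card_le hCS (by rw [hC.card_eq, hk])
      exact ⟨0, by simp, fun u hu _ _ hu' => absurd hu hu', fun v hv hv' => absurd hv hv'⟩

/-- The sub-`k`-trees containing `C` are the sets closed under taking neighbours of smaller
rank. -/
lemma IsElimRank.isKTreeOn_iff (hr : IsElimRank G k C S r) (hC : G.IsNClique k C) (hCA : C ⊆ A)
    (hAS : A ⊆ S) : IsKTreeOn G k A ↔ ∀ v ∈ A, v ∉ C → backNbr G r S v ⊆ A := by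
  induction hn : A.card generalizing A with
  | zero =>
    obtain rfl := card_eq_zero.1 hn
    obtain rfl := subset_empty.1 hCA
    exact ⟨by simp, fun _ => .base _ hC⟩
  | succ n ih =>
    rcases (A \ C).eq_empty_or_nonempty with hAC | hAC
    · obtain rfl := Subset.antisymm (sdiff_eq_empty_iff_subset.1 hAC) hCA
      exact ⟨fun _ v hv hv' => absurd hv hv', fun _ => .base _ hC⟩
    · obtain ⟨v, hv, hmax⟩ := exists_max_image (A \ C) r hAC
      rw [mem_sdiff] at hv
      obtain ⟨hvA, hvC⟩ := hv
      have hlt : ∀ w ∈ A, w ≠ v → r w < r v := by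
        intro w hw hwv
        by_cases hwC : w ∈ C
        · exact hr.lt_of_mem (hAS hw) hwC (hAS hvA) hvC
        · exact lt_of_le_of_ne (hmax w (mem_sdiff.2 ⟨hw, hwC⟩))
            fun h => hwv (hr.eq_of_eq w (hAS hw) v (hAS hvA) hwC h)
      have hsub : nbrIn G A v ⊆ backNbr G r S v := fun w hw => by
        rw [mem_nbrIn] at hw
        exact mem_backNbr.2 ⟨hAS hw.1, hw.2, hlt w hw.1 hw.2.ne'⟩
      have hback := hr.isNClique v (hAS hvA) hvC
      have hCv : C ⊆ A.erase v := subset_erase.2 ⟨hCA, hvC⟩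
      have hkA : k < A.card := by
        have := card_le_card hCv
        rw [card_erase_of_mem hvA, hC.card_eq] at this
        omega
      have ih' := ih hCv ((erase_subset _ _).trans hAS)
        (by rw [card_erase_of_mem hvA, hn]; rfl)
      constructor
      · intro hT
        have heq : nbrIn G A v = backNbr G r S v :=
          eq_of_subset_of_card_le hsub (by rw [hback.card_eq]; exact hT.le_card_nbrIn hkA hvA)
        have hT' := (hT.erase_leaf hkA hvA (by rw [heq, hback.card_eq])).1
        intro w hw hwC
        rcases eq_or_ne w v with rfl | hwv
        · exact heq ▸ fun x hx => (mem_nbrIn.1 hx).1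
        · exact ((ih'.1 hT') w (mem_erase.2 ⟨hwv, hw⟩) hwC).trans (erase_subset _ _)
      · intro hcl
        have hT' := ih'.2 fun w hw hwC => subset_erase.2
          ⟨hcl w (mem_of_mem_erase hw) hwC, fun hvw => ?_⟩
        · rw [← insert_erase hvA]
          refine .grow _ v (backNbr G r S v) hT' (notMem_erase _ _)
            (subset_erase.2 ⟨hcl v hvA hvC, by simp⟩) hback fun w hw => ?_
          rw [mem_erase] at hw
          exact ⟨fun h => hsub (mem_nbrIn.2 ⟨hw.2, h⟩), fun h => (mem_backNbr.1 h).2.1⟩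
        · rw [mem_erase] at hw
          exact lt_asymm (hlt w hw.2 hw.1) (mem_backNbr.1 hvw).2.2

end Elimination

section Ancestors

variable [Fintype V] {G : SimpleGraph V} {k : ℕ} {A C : Finset V} {r : V → ℕ} {u u' v w : V}
  {l : List V}

/-- `u` is the last neighbour of `v`, outside `C`, of smaller rank. -/
def IsParent (G : SimpleGraph V) (C : Finset V) (r : V → ℕ) (u v : V) : Prop :=
  u ∉ C ∧ u ∈ backNbr G r univ v ∧ ∀ w ∈ backNbr G r univ v, r w ≤ r u

/-- `l` lists the proper ancestors of `v` outside `C`, beginning with the oldest one. -/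
inductive IsAncestorList (G : SimpleGraph V) (C : Finset V) (r : V → ℕ) : List V → V → Prop
  | root (v : V) : v ∉ C → backNbr G r univ v = C → IsAncestorList G C r [] v
  | step (l : List V) (u v : V) : IsAncestorList G C r l u → IsParent G C r u v →
      IsAncestorList G C r (l ++ [u]) v

namespace IsParent

lemma rank_lt (h : IsParent G C r u v) : r u < r v := (mem_backNbr.1 h.2.1).2.2

lemma notMem (hr : IsElimRank G k C univ r) (h : IsParent G C r u v) : v ∉ C :=
  hr.notMem_of_mem_backNbr (mem_univ v) h.2.1

lemma unique (hr : IsElimRank G k C univ r)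
    (h : IsParent G C r u v) (h' : IsParent G C r u' v) : u = u' :=
  hr.eq_of_eq _ (mem_univ _) _ (mem_univ _) h.1
    (le_antisymm (h'.2.2 u h.2.1) (h.2.2 u' h'.2.1))

lemma backNbr_subset [DecidableEq V] (hr : IsElimRank G k C univ r) (h : IsParent G C r u v) :
    backNbr G r univ v ⊆ insert u (backNbr G r univ u) := by
  intro w hw
  rcases eq_or_ne w u with rfl | hne
  · exact mem_insert_self _ _
  · refine mem_insert_of_mem (mem_backNbr.2 ⟨mem_univ _, ?_, ?_⟩)
    · exact (hr.isNClique v (mem_univ v) (h.notMem hr)).isClique h.2.1 hw hne.symm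
    · exact lt_of_le_of_ne (h.2.2 w hw) fun heq =>
        hne (hr.eq_of_eq _ (mem_univ _) _ (mem_univ _) h.1 heq.symm).symm

end IsParent

lemma IsElimRank.backNbr_eq_or_exists_isParent (hr : IsElimRank G k C univ r)
    (hC : G.IsNClique k C) (hv : v ∉ C) :
    backNbr G r univ v = C ∨ ∃ u, IsParent G C r u v := by
  have hQ := hr.isNClique v (mem_univ v) hv
  by_cases h : backNbr G r univ v ⊆ C
  · exact Or.inl (eq_of_subset_of_card_le h (by rw [hQ.card_eq, hC.card_eq]))
  · obtain ⟨w, hw, hwC⟩ := not_subset.1 h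
    obtain ⟨u, hu, hmax⟩ := exists_max_image _ r ⟨w, hw⟩
    refine Or.inr ⟨u, fun huC => ?_, hu, hmax⟩
    exact (hr.lt_of_mem (mem_univ _) huC (mem_univ _) hwC).not_ge (hmax w hw)

lemma IsElimRank.exists_isAncestorList (hr : IsElimRank G k C univ r)
    (hC : G.IsNClique k C) (hv : v ∉ C) :
    ∃ l, IsAncestorList G C r l v := by
  induction hn : r v using Nat.strong_induction_on generalizing v with
  | _ n ih =>
    rcases hr.backNbr_eq_or_exists_isParent hC hv with h | ⟨u, h⟩
    · exact ⟨[], .root v hv h⟩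
    · obtain ⟨l, hl⟩ := ih (r u) (hn ▸ h.rank_lt) h.1 rfl
      exact ⟨_, .step l u v hl h⟩

namespace IsAncestorList

lemma notMem (hr : IsElimRank G k C univ r) (h : IsAncestorList G C r l v) : v ∉ C := by
  cases h with
  | root _ hv => exact hv
  | step _ _ _ _ h => exact h.notMem hr

lemma forall_mem (h : IsAncestorList G C r l v) : ∀ x ∈ l, x ∉ C ∧ r x < r v := by
  induction h with
  | root => simp
  | step l u v h hp ih =>
    intro x hx
    rcases List.mem_append.1 hx with hx | hx
    · exact ⟨(ih x hx).1, (ih x hx).2.trans hp.rank_lt⟩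
    · obtain rfl := List.mem_singleton.1 hx
      exact ⟨hp.1, hp.rank_lt⟩

lemma backNbr_eq_of_head (h : IsAncestorList G C r l v) {y : V}
    (hy : (l ++ [v]).head? = some y) : backNbr G r univ y = C := by
  induction h with
  | root v _ hv => simp at hy; rwa [← hy]
  | step l u v h hp ih => exact ih (by simpa [List.head?_append] using hy)

lemma isParent_of_infix (h : IsAncestorList G C r l v) {x y : V} (hxy : [x, y] <:+: l ++ [v]) :
    IsParent G C r x y := by
  induction h with
  | root v => exact absurd hxy.length_le (by simp)
  | step l u v h hp ih =>
    rcases List.infix_concat_iff.1 hxy with ⟨t, ht⟩ | h'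
    · have := (List.append_inj' (s₁ := t) (t₁ := [x, y]) (s₂ := l) (t₂ := [u, v])
        (by simpa using ht) rfl).2
      simp only [List.cons.injEq, and_true] at this
      rwa [this.1, this.2]
    · exact ih h'

/-- Every ancestor list extends to one ending in a `k`-leaf. -/
lemma exists_prefix_leaf (hr : IsElimRank G k C univ r) (h : IsAncestorList G C r l v) :
    ∃ l' v', IsAncestorList G C r l' v' ∧ l ++ [v] <+: l' ++ [v'] ∧
      (G.neighborSet v').ncard = k := by
  induction hn : univ.sup r - r v using Nat.strong_induction_on generalizing l v with
  | _ n ih =>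
    have hv := h.notMem hr
    have hQ := hr.isNClique v (mem_univ v) hv
    by_cases hd : ∃ x, G.Adj v x ∧ r v < r x
    · classical
      obtain ⟨x, hx, hmin⟩ := exists_min_image (univ.filter fun x => v ∈ backNbr G r univ x) r
        (by
          obtain ⟨x, hx⟩ := hd
          exact ⟨x, by simpa using ⟨hx.1.symm, hx.2⟩⟩)
      simp only [mem_filter, mem_univ, true_and] at hx hmin
      have hxv := (mem_backNbr.1 hx).2
      have hp : IsParent G C r v x := by
        refine ⟨hv, hx, fun w hw => ?_⟩
        by_contra! hvw
        have hadj := (hr.isNClique x (mem_univ x)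
          (hr.notMem_of_mem_backNbr (mem_univ x) hx)).isClique hw hx
            (fun h => hvw.ne (h ▸ rfl))
        exact (mem_backNbr.1 hw).2.2.not_ge
          (hmin w (mem_backNbr.2 ⟨mem_univ _, hadj, hvw⟩))
      have := le_sup (f := r) (mem_univ x)
      obtain ⟨l', v', h1, h2, h3⟩ := ih _ (by omega) (.step l v x h hp) rfl
      exact ⟨l', v', h1, (List.prefix_append _ _).trans h2, h3⟩
    · refine ⟨l, v, h, List.prefix_rfl, ?_⟩
      rw [← hQ.card_eq, ← Set.ncard_coe_finset]
      congr 1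
      ext x
      simp only [SimpleGraph.mem_neighborSet, mem_coe, mem_backNbr, mem_univ, true_and]
      refine ⟨fun hx => ⟨hx, ?_⟩, fun hx => hx.1⟩
      refine lt_of_le_of_ne (not_lt.1 fun hlt => hd ⟨x, hx, hlt⟩) fun heq => ?_
      exact hx.ne (hr.eq_of_eq _ (mem_univ _) _ (mem_univ _) hv heq.symm)

lemma nodup (h : IsAncestorList G C r l v) : (l ++ [v]).Nodup := by
  have aux {l v} (h : IsAncestorList G C r l v) (hl : l.Nodup) : (l ++ [v]).Nodup :=
    List.nodup_append.2 ⟨hl, by simp, fun a ha b hb hab => by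
      obtain rfl := List.mem_singleton.1 hb
      exact (h.forall_mem a ha).2.ne (hab ▸ rfl)⟩
  induction h with
  | root => simp
  | step l u v h hp ih => exact aux (.step l u v h hp) ih

variable [DecidableEq V]

lemma backNbr_subset (hr : IsElimRank G k C univ r) (h : IsAncestorList G C r l v) :
    backNbr G r univ v ⊆ C ∪ l.toFinset := by
  induction h with
  | root v _ hv => simp [hv]
  | step l u v h hp ih =>
    refine (hp.backNbr_subset hr).trans (insert_subset (by simp) (ih.trans ?_))
    intro x
    simp only [mem_union, List.mem_toFinset, List.mem_append]
    tauto

lemma rank_lt_of_mem (hr : IsElimRank G k C univ r)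
    (h : IsAncestorList G C r l v) (hw : w ∈ C ∪ l.toFinset) : r w < r v := by
  rcases mem_union.1 hw with hw | hw
  · exact hr.lt_of_mem (mem_univ _) hw (mem_univ _) (h.notMem hr)
  · exact (h.forall_mem w (List.mem_toFinset.1 hw)).2

lemma notMem_union (hr : IsElimRank G k C univ r)
    (h : IsAncestorList G C r l v) : v ∉ C ∪ l.toFinset := fun hv =>
  lt_irrefl _ (h.rank_lt_of_mem hr hv)

lemma adj_iff (hr : IsElimRank G k C univ r) (h : IsAncestorList G C r l v) :
    ∀ w ∈ C ∪ l.toFinset, G.Adj v w ↔ w ∈ backNbr G r univ v := fun w hw => by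
  simp [h.rank_lt_of_mem hr hw]

lemma nbrIn_insert_eq (hr : IsElimRank G k C univ r) (h : IsAncestorList G C r l v) :
    nbrIn G (insert v (C ∪ l.toFinset)) v = backNbr G r univ v :=
  nbrIn_insert_self (h.backNbr_subset hr) (h.adj_iff hr)

lemma isPEO (hr : IsElimRank G k C univ r)
    (h : IsAncestorList G C r l v) : IsPEO G k C (l ++ [v]) := by
  have aux {l v} (h : IsAncestorList G C r l v) (hl : IsPEO G k C l) :
      IsPEO G k C (l ++ [v]) := by
    refine .snoc l v hl (h.notMem hr) (fun hv => lt_irrefl _ (h.forall_mem v hv).2) ?_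
    rw [ncard_neighborSet_inter_union,
      ← nbrIn_insert_of_not_adj (G.loopless.irrefl v), h.nbrIn_insert_eq hr,
      (hr.isNClique v (mem_univ v) (h.notMem hr)).card_eq]
  induction h with
  | root v hv hQ => exact aux (.root v hv hQ) .nil
  | step l u v h hp ih => exact aux (.step l u v h hp) ih

lemma isPathTypeOn (hr : IsElimRank G k C univ r)
    (hC : G.IsNClique k C) (h : IsAncestorList G C r l v) :
    IsPathTypeOn G k (insert v (C ∪ l.toFinset)) := by
  induction h with
  | root v hv hQ =>
    refine .base₂ _ ?_
    simp only [List.toFinset_nil, union_empty]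
    exact hC.insert fun w hw => (mem_backNbr.1 (hQ.symm ▸ hw)).2.1
  | step l u v h hp ih =>
    have h' := IsAncestorList.step l u v h hp
    have hQ := hr.isNClique v (mem_univ v) (hp.notMem hr)
    refine .grow _ v (backNbr G r univ v) ?_ ?_ (h'.notMem_union hr) (h'.backNbr_subset hr)
      hQ ⟨u, hp.2.1, ?_⟩ (h'.adj_iff hr)
    · rwa [union_concat_toFinset]
    · rw [union_concat_toFinset, card_insert_of_notMem (h.notMem_union hr), ← hC.card_eq]
      exact Nat.succ_le_succ (card_le_card subset_union_left)
    · rw [ncard_neighborSet_inter _ rfl, union_concat_toFinset, h.nbrIn_insert_eq hr,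
        (hr.isNClique u (mem_univ u) hp.1).card_eq]

/-- In the `k`-tree spanned by `C` and an ancestor list, `C` is simplicial. -/
lemma exists_leaf_mem (hr : IsElimRank G k C univ r)
    (hC : G.IsNClique k C) (hk : 1 ≤ k) (h : IsAncestorList G C r l v) :
    ∃ ℓ ∈ C, (nbrIn G (insert v (C ∪ l.toFinset)) ℓ).card = k := by
  suffices H : (backNbr G r univ v = C ∧
        ∀ ℓ ∈ C, (nbrIn G (insert v (C ∪ l.toFinset)) ℓ).card = k) ∨
      ∃ ℓ ∈ C, ℓ ∉ backNbr G r univ v ∧ (nbrIn G (insert v (C ∪ l.toFinset)) ℓ).card = k by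
    rcases H with ⟨_, H⟩ | ⟨ℓ, hℓ, _, H⟩
    · obtain ⟨ℓ, hℓ⟩ : C.Nonempty := card_pos.1 (by rw [hC.card_eq]; omega)
      exact ⟨ℓ, hℓ, H ℓ hℓ⟩
    · exact ⟨ℓ, hℓ, H⟩
  induction h with
  | root v hv hQ =>
    refine Or.inl ⟨hQ, fun ℓ hℓ => ?_⟩
    simp only [List.toFinset_nil, union_empty]
    exact card_nbrIn_of_isNClique (hC.insert fun w hw => (mem_backNbr.1 (hQ.symm ▸ hw)).2.1)
      (mem_insert_of_mem hℓ)
  | step l u v h hp ih =>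
    have h' := IsAncestorList.step l u v h hp
    have hQ := hr.isNClique v (mem_univ v) (hp.notMem hr)
    right
    obtain ⟨ℓ, hℓ, hℓv, hd⟩ : ∃ ℓ ∈ C, ℓ ∉ backNbr G r univ v ∧
        (nbrIn G (insert u (C ∪ l.toFinset)) ℓ).card = k := by
      rcases ih with ⟨_, ih⟩ | ⟨ℓ, hℓ, hℓu, hd⟩
      · obtain ⟨ℓ, hℓ, hℓv⟩ : ∃ ℓ ∈ C, ℓ ∉ backNbr G r univ v := by
          rw [← not_subset]
          intro hsub
          have := eq_of_subset_of_card_le hsub (by rw [hQ.card_eq, hC.card_eq])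
          exact hp.1 (this ▸ hp.2.1)
        exact ⟨ℓ, hℓ, hℓv, ih ℓ hℓ⟩
      · refine ⟨ℓ, hℓ, fun hℓv => ?_, hd⟩
        rcases mem_insert.1 (hp.backNbr_subset hr hℓv) with rfl | hℓ'
        · exact hp.1 hℓ
        · exact hℓu hℓ'
    refine ⟨ℓ, hℓ, hℓv, ?_⟩
    have hadj : ¬ G.Adj ℓ v := fun h =>
      hℓv ((h'.adj_iff hr ℓ (mem_union_left _ hℓ)).1 h.symm)
    rwa [nbrIn_insert_of_not_adj hadj, union_concat_toFinset]

lemma isCanonPath (hr : IsElimRank G k C univ r)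
    (hC : G.IsNClique k C) (hk : 1 ≤ k) (h : IsAncestorList G C r l v) :
    IsCanonPath G k C (l ++ [v]) := by
  refine ⟨by simp, h.nodup, fun x hx => ?_, ?_, ?_, h.isPEO hr⟩
  · rcases List.mem_append.1 hx with hx | hx
    · exact (h.forall_mem x hx).1
    · exact List.mem_singleton.1 hx ▸ h.notMem hr
  · rw [union_concat_toFinset]
    exact h.isPathTypeOn hr hC
  · obtain ⟨ℓ, hℓ, hd⟩ := h.exists_leaf_mem hr hC hk
    exact ⟨ℓ, hℓ, by rw [ncard_neighborSet_inter_union, union_concat_toFinset, hd]⟩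

end IsAncestorList

end Ancestors

section CanonicalPaths

variable [DecidableEq V] {G : SimpleGraph V} {k : ℕ} {C : Finset V} {r : V → ℕ} {v : V}
  {l : List V}

lemma IsPEO.of_concat (h : IsPEO G k C (l ++ [v])) :
    IsPEO G k C l ∧ v ∉ C ∪ l.toFinset ∧ (nbrIn G (C ∪ l.toFinset) v).card = k := by
  generalize hL : l ++ [v] = L at h
  cases h with
  | nil => simp at hL
  | snoc l' v' h hvC hvl hd =>
    obtain ⟨rfl, hv⟩ := List.append_inj' hL rfl
    obtain rfl := List.singleton_inj.1 hv
    rw [ncard_neighborSet_inter_union] at hd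
    exact ⟨h, by simp [hvC, hvl], hd⟩

lemma IsPEO.notMem (h : IsPEO G k C l) : ∀ x ∈ l, x ∉ C := by
  induction h with
  | nil => simp
  | snoc l v _ hv _ _ ih =>
    intro x hx
    rcases List.mem_append.1 hx with hx | hx
    · exact ih x hx
    · exact List.mem_singleton.1 hx ▸ hv

variable [Fintype V]

/-- If the last vertex of a perfect elimination ordering is the only `k`-leaf outside `C`, then
the ordering runs through the ancestors of that vertex. -/
lemma IsElimRank.isAncestorList_of_isPEO (hr : IsElimRank G k C univ r) (hC : G.IsNClique k C)
    (hL : IsPEO G k C (l ++ [v])) (hT : IsKTreeOn G k (insert v (C ∪ l.toFinset)))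
    (hleaf : ∀ x ∈ l, (nbrIn G (insert v (C ∪ l.toFinset)) x).card ≠ k) :
    IsAncestorList G C r l v := by
  have hback : ∀ {S : Finset V} {x : V}, C ⊆ S → IsKTreeOn G k S → x ∈ S → x ∉ C →
      (nbrIn G S x).card = k → nbrIn G S x = backNbr G r univ x := by
    intro S x hCS hS hx hxC hd
    have hQ := hr.isNClique x (mem_univ x) hxC
    refine (eq_of_subset_of_card_le (fun w hw => mem_nbrIn.2
      ⟨(hr.isKTreeOn_iff hC hCS (subset_univ S)).1 hS x hx hxC hw, (mem_backNbr.1 hw).2.1⟩)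
      (by rw [hQ.card_eq, hd])).symm
  induction l using List.reverseRecOn generalizing v with
  | nil =>
    obtain ⟨_, hv, hd⟩ := hL.of_concat
    simp only [List.toFinset_nil, union_empty] at hv hd hT
    have hQ := hr.isNClique v (mem_univ v) hv
    refine .root v hv ?_
    rw [← nbrIn_insert_of_not_adj (G.loopless.irrefl v)] at hd
    rw [← hback (subset_insert _ _) hT (mem_insert_self _ _) hv hd,
      nbrIn_insert_of_not_adj (G.loopless.irrefl v)] at hQ ⊢
    exact eq_of_subset_of_card_le (fun w hw => (mem_nbrIn.1 hw).1)
      (by rw [hQ.card_eq, hC.card_eq])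
  | append_singleton l u ih =>
    obtain ⟨hL', hvS, hdv⟩ := hL.of_concat
    obtain ⟨hL'', huS, hdu⟩ := hL'.of_concat
    set S := C ∪ (l ++ [u]).toFinset with hS
    have hS' : S = insert u (C ∪ l.toFinset) := union_concat_toFinset C l u
    have huS' : u ∈ S := hS' ▸ mem_insert_self _ _
    have huC : u ∉ C := fun h => huS (mem_union_left _ h)
    have hvC : v ∉ C := fun h => hvS (mem_union_left _ h)
    have hCS : C ⊆ S := subset_union_left
    have hne : ∀ x ∈ l ++ [u], x ≠ v := fun x hx hxv =>
      hvS (mem_union_right _ (List.mem_toFinset.2 (hxv ▸ hx)))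
    rw [← nbrIn_insert_of_not_adj (G.loopless.irrefl u), ← hS'] at hdu
    have hk : k < S.card := by
      rw [hS', card_insert_of_notMem huS, ← hC.card_eq]
      exact Nat.lt_succ_of_le (card_le_card subset_union_left)
    have hdv' := hdv
    rw [← nbrIn_insert_of_not_adj (G.loopless.irrefl v)] at hdv'
    have hNv := hback (hCS.trans (subset_insert _ _)) hT (mem_insert_self _ _) hvC hdv'
    rw [nbrIn_insert_of_not_adj (G.loopless.irrefl v)] at hNv
    have hTS : IsKTreeOn G k S := by
      have := (hT.erase_leaf (by rw [card_insert_of_notMem hvS]; omega)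
        (mem_insert_self _ _) hdv').1
      rwa [erase_insert hvS] at this
    have hNu := hback hCS hTS huS' huC hdu
    have hcl := (hr.isNClique v (mem_univ v) hvC).isClique
    have hleaf' : ∀ x ∈ l ++ [u], (nbrIn G S x).card = k → G.Adj x v := by
      intro x hx hd
      by_contra hxv
      exact hleaf x hx (by rwa [nbrIn_insert_of_not_adj hxv])
    have huv : u ∈ backNbr G r univ v :=
      hNv ▸ mem_nbrIn.2 ⟨huS', (hleaf' u (by simp) hdu).symm⟩
    refine .step l u v (ih hL' (hS' ▸ hTS) ?_) ⟨huC, huv, fun w hw => ?_⟩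
    · intro x hx hd
      rw [← hS'] at hd
      have hxS : x ∈ C ∪ l.toFinset := mem_union_right _ (List.mem_toFinset.2 hx)
      have hxu : x ≠ u := fun h => huS (h ▸ hxS)
      have hxS' : x ∈ S := hS' ▸ mem_insert_of_mem hxS
      have hxC : x ∉ C := hL''.notMem x hx
      have hxv : x ∈ backNbr G r univ v :=
        hNv ▸ mem_nbrIn.2 ⟨hxS', (hleaf' x (by simp [hx]) hd).symm⟩
      refine hTS.not_adj_of_leaves ?_ huS' hxS' hdu hd (hcl hxv huv hxu)
      rw [hS', card_insert_of_notMem huS, ← hC.card_eq]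
      exact Nat.succ_le_succ (card_lt_card
        (Finset.ssubset_iff_subset_ne.2 ⟨subset_union_left, fun h => hxC (h ▸ hxS)⟩))
    · by_contra! hlt
      have hwS : w ∈ S := (mem_nbrIn.1 (hNv.symm ▸ hw)).1
      have hadj : G.Adj u w := hcl huv hw fun h => hlt.ne (h ▸ rfl)
      exact lt_asymm hlt (mem_backNbr.1 (hNu ▸ mem_nbrIn.2 ⟨hwS, hadj⟩)).2.2

lemma IsCanonPath.isAncestorList (h : IsCanonPath G k C (l ++ [v]))
    (hr : IsElimRank G k C univ r) (hC : G.IsNClique k C) : IsAncestorList G C r l v := by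
  obtain ⟨_, _, hnotC, hpath, ⟨ℓ, hℓC, hℓ⟩, hpeo⟩ := h
  rw [ncard_neighborSet_inter_union] at hℓ
  rw [union_concat_toFinset] at hℓ hpath
  obtain ⟨_, hvS, hdv⟩ := hpeo.of_concat
  rw [← nbrIn_insert_of_not_adj (G.loopless.irrefl v)] at hdv
  refine hr.isAncestorList_of_isPEO hC hpeo hpath.isKTreeOn fun x hx hd => ?_
  have hxS : x ∈ C ∪ l.toFinset := mem_union_right _ (List.mem_toFinset.2 hx)
  have hxC : x ∉ C := hnotC x (by simp [hx])
  have hcard : k + 2 ≤ (insert v (C ∪ l.toFinset)).card := by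
    rw [card_insert_of_notMem hvS, ← hC.card_eq]
    exact Nat.succ_le_succ (card_lt_card
      (Finset.ssubset_iff_subset_ne.2 ⟨subset_union_left, fun h => hxC (h ▸ hxS)⟩))
  obtain ⟨a, b, hab⟩ := hpath.exists_leaves_subset_pair hcard
  have h1 := hab x (mem_insert_of_mem hxS) hd
  have h2 := hab v (mem_insert_self _ _) hdv
  have h3 := hab ℓ (mem_insert_of_mem (mem_union_left _ hℓC)) hℓ
  have hxv : x ≠ v := fun h => hvS (h ▸ hxS)
  have hxℓ : x ≠ ℓ := fun h => hxC (h ▸ hℓC)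
  have hvℓ : v ≠ ℓ := fun h => hvS (h ▸ mem_union_left _ hℓC)
  grind

end CanonicalPaths

section ToCharTree

variable [DecidableEq V] {C : Finset V}

/-- The set of vertices of `T'_C` corresponding to a vertex set `A ⊇ C`. -/
def toCharTree (C A : Finset V) : Finset (Option {x : V // x ∉ C}) :=
  insertNone (A.subtype (· ∉ C))

lemma card_toCharTree {A : Finset V} (hCA : C ⊆ A) :
    A.card + 1 = (toCharTree C A).card + C.card := by
  have : (A.filter (· ∉ C)).card + C.card = A.card := by
    rw [filter_notMem_eq_sdiff, card_sdiff_add_card_eq_card hCA]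
  rw [toCharTree, card_insertNone, card_subtype]
  omega

lemma toCharTree_injOn {A B : Finset V} (hA : C ⊆ A) (hB : C ⊆ B)
    (h : toCharTree C A = toCharTree C B) : A = B := by
  ext x
  by_cases hx : x ∈ C
  · simp [hA hx, hB hx]
  · simpa [toCharTree] using congrArg (some ⟨x, hx⟩ ∈ ·) h

lemma exists_toCharTree_eq {B : Finset (Option {x : V // x ∉ C})} (hB : none ∈ B) :
    ∃ A, C ⊆ A ∧ toCharTree C A = B := by
  refine ⟨C ∪ (eraseNone B).map (Function.Embedding.subtype _), subset_union_left, ?_⟩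
  ext b
  cases b with
  | none => simp [toCharTree, hB]
  | some v => simp [toCharTree, v.2]

end ToCharTree

section CharTree

variable [Fintype V] {G : SimpleGraph V} {k : ℕ} {C : Finset V} {r : V → ℕ}

/-- The parent relation of the characteristic tree, in which `none` stands for `C`. -/
def IsParentOpt (G : SimpleGraph V) (C : Finset V) (r : V → ℕ) (a : Option {x : V // x ∉ C})
    (v : {x : V // x ∉ C}) : Prop :=
  (a = none ∧ backNbr G r univ v = C) ∨ ∃ u : {x : V // x ∉ C}, a = some u ∧ IsParent G C r u v

lemma IsElimRank.existsUnique_isParentOpt (hr : IsElimRank G k C univ r)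
    (hC : G.IsNClique k C) (v : {x : V // x ∉ C}) : ∃! a, IsParentOpt G C r a v := by
  rcases hr.backNbr_eq_or_exists_isParent hC v.2 with h | ⟨u, h⟩
  · refine ⟨none, Or.inl ⟨rfl, h⟩, ?_⟩
    rintro _ (⟨rfl, _⟩ | ⟨u, rfl, hu⟩)
    · rfl
    · exact absurd (h.subset hu.2.1) u.2
  · refine ⟨some ⟨u, h.1⟩, Or.inr ⟨_, rfl, h⟩, ?_⟩
    rintro _ (⟨rfl, h'⟩ | ⟨u', rfl, hu⟩)
    · exact absurd (h'.subset h.2.1) h.1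
    · exact congrArg some (Subtype.ext (hu.unique hr h))

lemma IsParentOpt.ne {a : Option {x : V // x ∉ C}} {v : {x : V // x ∉ C}}
    (h : IsParentOpt G C r a v) : a ≠ some v := by
  rintro rfl
  obtain ⟨h, _⟩ | ⟨u, hu, h⟩ := h
  · simp at h
  · obtain rfl := Option.some_injective _ hu
    exact lt_irrefl _ h.rank_lt

variable [DecidableEq V]

/-- The characteristic tree joins each vertex to its parent. -/
lemma IsElimRank.charTree_adj_iff (hr : IsElimRank G k C univ r) (hk : 1 ≤ k)
    (hC : G.IsNClique k C) (a b : Option {x : V // x ∉ C}) :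
    (charTree G k C).Adj a b ↔
      (∃ v, IsParentOpt G C r a v ∧ b = some v) ∨ ∃ v, IsParentOpt G C r b v ∧ a = some v := by
  have key : ∀ a b : Option {x : V // x ∉ C}, (∃ L : List V, IsCanonPath G k C L ∧
      (∃ v, L.getLast? = some v ∧ (G.neighborSet v).ncard = k) ∧
      ((a = none ∧ ∃ y : {x : V // x ∉ C}, b = some y ∧ L.head? = some y.val) ∨
        (∃ x y : {x : V // x ∉ C}, a = some x ∧ b = some y ∧ [x.val, y.val] <:+: L))) ↔
      ∃ v, IsParentOpt G C r a v ∧ b = some v := by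
    intro a b
    constructor
    · rintro ⟨L, hL, -, h⟩
      obtain ⟨l, v, rfl⟩ : ∃ l v, L = l ++ [v] :=
        ⟨_, _, (List.dropLast_append_getLast hL.1).symm⟩
      have hanc := hL.isAncestorList hr hC
      rcases h with ⟨rfl, y, rfl, hy⟩ | ⟨x, y, rfl, rfl, hxy⟩
      · exact ⟨y, Or.inl ⟨rfl, hanc.backNbr_eq_of_head hy⟩, rfl⟩
      · exact ⟨y, Or.inr ⟨x, rfl, hanc.isParent_of_infix hxy⟩, rfl⟩
    · rintro ⟨v, h, rfl⟩
      rcases h with ⟨rfl, hv⟩ | ⟨u, rfl, hu⟩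
      · obtain ⟨l, w, hl, hpre, hw⟩ :=
          (IsAncestorList.root v.1 v.2 hv).exists_prefix_leaf hr
        refine ⟨_, hl.isCanonPath hr hC hk, ⟨w, by simp, hw⟩, Or.inl ⟨rfl, v, rfl, ?_⟩⟩
        obtain ⟨t, ht⟩ := hpre
        simp [← ht]
      · obtain ⟨m, hm⟩ := hr.exists_isAncestorList hC u.2
        obtain ⟨l, w, hl, hpre, hw⟩ :=
          (IsAncestorList.step m u.1 v.1 hm hu).exists_prefix_leaf hr
        refine ⟨_, hl.isCanonPath hr hC hk, ⟨w, by simp, hw⟩,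
          Or.inr ⟨u, v, rfl, rfl, List.IsInfix.trans ⟨m, [], by simp⟩ hpre.isInfix⟩⟩
  rw [charTree, SimpleGraph.fromRel_adj, key, key]
  refine and_iff_right_of_imp ?_
  rintro (⟨v, h, rfl⟩ | ⟨v, h, rfl⟩)
  · exact h.ne
  · exact h.ne.symm

/-- A vertex set containing `none` spans a subtree of the characteristic tree if and only if it is
closed under taking parents. -/
lemma IsElimRank.connected_induce_charTree_iff (hr : IsElimRank G k C univ r) (hk : 1 ≤ k)
    (hC : G.IsNClique k C) {B : Set (Option {x : V // x ∉ C})} (hB : none ∈ B) :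
    ((charTree G k C).induce B).Connected ↔
      ∀ a v, IsParentOpt G C r a v → some v ∈ B → a ∈ B := by
  constructor
  · intro hconn a v hav hv
    by_contra ha
    let D := {b | Relation.ReflTransGen (fun b c => ∃ w, IsParentOpt G C r b w ∧ c = some w)
      (some v) b}
    have hstep : ∀ x y : B, ((charTree G k C).induce B).Adj x y → x.1 ∈ D → y.1 ∈ D := by
      rintro ⟨x, hx⟩ ⟨y, hy⟩ hxy hxD
      rcases (hr.charTree_adj_iff hk hC x y).1 hxy with h | ⟨w, hw, rfl⟩
      · exact Relation.ReflTransGen.tail hxD h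
      · rcases Relation.ReflTransGen.cases_tail hxD with h | ⟨c, hc, w', hw', h⟩
        · obtain rfl := Option.some_injective _ h
          exact absurd ((hr.existsUnique_isParentOpt hC w).unique hw hav ▸ hy) ha
        · obtain rfl := Option.some_injective _ h
          exact (hr.existsUnique_isParentOpt hC w).unique hw hw' ▸ hc
    have hreach : ∀ x y : B, ((charTree G k C).induce B).Walk x y → x.1 ∈ D → y.1 ∈ D := by
      intro x y p
      induction p with
      | nil => exact id
      | cons h _ ih => exact fun hx => ih (hstep _ _ h hx)
    obtain ⟨p⟩ := hconn.preconnected ⟨some v, hv⟩ ⟨none, hB⟩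
    rcases Relation.ReflTransGen.cases_tail (hreach _ _ p .refl) with h | ⟨_, _, _, _, h⟩ <;>
      simp at h
  · intro hcl
    suffices H : ∀ n, ∀ v : {x : V // x ∉ C}, r v = n → ∀ hv : some v ∈ B,
        ((charTree G k C).induce B).Reachable ⟨some v, hv⟩ ⟨none, hB⟩ by
      refine (SimpleGraph.connected_iff_exists_forall_reachable _).2
        ⟨⟨none, hB⟩, fun ⟨b, hb⟩ => ?_⟩
      cases b with
      | none => exact .refl _
      | some v => exact (H _ v rfl hb).symm
    intro n
    induction n using Nat.strong_induction_on with
    | _ n ih =>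
      intro v hn hv
      obtain ⟨a, ha, -⟩ := hr.existsUnique_isParentOpt hC v
      have haB := hcl a v ha hv
      have hadj : ((charTree G k C).induce B).Adj ⟨some v, hv⟩ ⟨a, haB⟩ :=
        (hr.charTree_adj_iff hk hC _ _).2 (Or.inr ⟨v, ha, rfl⟩)
      refine hadj.reachable.trans ?_
      rcases ha with ⟨rfl, _⟩ | ⟨u, rfl, hu⟩
      · exact .refl _
      · exact ih _ (hn ▸ hu.rank_lt) u rfl haB

lemma IsElimRank.forall_backNbr_subset_iff (hr : IsElimRank G k C univ r)
    (hC : G.IsNClique k C) {A : Finset V} (hCA : C ⊆ A) :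
    (∀ v ∈ A, v ∉ C → backNbr G r univ v ⊆ A) ↔ ∀ u v, IsParent G C r u v → v ∈ A → u ∈ A := by
  constructor
  · exact fun h u v huv hv => h v hv (huv.notMem hr) huv.2.1
  · intro h v hv hvC
    induction hn : r v using Nat.strong_induction_on generalizing v with
    | _ n ih =>
      rcases hr.backNbr_eq_or_exists_isParent hC hvC with h' | ⟨u, hu⟩
      · rwa [h']
      · exact (hu.backNbr_subset hr).trans (insert_subset (h u v hu hv)
          (ih _ (hn ▸ hu.rank_lt) u (h u v hu hv) hu.1 rfl))

lemma mem_subKTrees {A : Finset V} : A ∈ subKTrees G k C ↔ C ⊆ A ∧ IsKTreeOn G k A := by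
  simp [subKTrees]

lemma mem_subtrees {A : Finset V} {w : V} :
    A ∈ subtrees G w ↔ w ∈ A ∧ (G.induce (A : Set V)).Connected := by
  simp [subtrees, subtreesIn]

lemma IsElimRank.toCharTree_mem_subtrees_iff (hr : IsElimRank G k C univ r) (hk : 1 ≤ k)
    (hC : G.IsNClique k C) {A : Finset V} (hCA : C ⊆ A) :
    toCharTree C A ∈ subtrees (charTree G k C) none ↔ A ∈ subKTrees G k C := by
  have hnone : none ∈ toCharTree C A := by simp [toCharTree]
  rw [mem_subtrees, mem_subKTrees, and_iff_right hnone, and_iff_right hCA,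
    hr.connected_induce_charTree_iff hk hC (mem_coe.2 hnone),
    hr.isKTreeOn_iff hC hCA (subset_univ A), hr.forall_backNbr_subset_iff hC hCA]
  constructor
  · intro h u v huv hv
    have := h (some ⟨u, huv.1⟩) ⟨v, huv.notMem hr⟩ (Or.inr ⟨_, rfl, huv⟩)
    simp only [toCharTree, mem_coe, some_mem_insertNone, mem_subtype] at this
    exact this hv
  · rintro h _ v (⟨rfl, _⟩ | ⟨u, rfl, hu⟩) hv
    · exact hnone
    · simp only [toCharTree, mem_coe, some_mem_insertNone, mem_subtype] at hv ⊢
      exact h u v hu hv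

lemma IsElimRank.subtrees_charTree (hr : IsElimRank G k C univ r) (hk : 1 ≤ k)
    (hC : G.IsNClique k C) :
    subtrees (charTree G k C) none = (subKTrees G k C).image (toCharTree C) := by
  ext B
  rw [mem_image]
  constructor
  · intro hB
    obtain ⟨A, hCA, rfl⟩ := exists_toCharTree_eq (mem_subtrees.1 hB).1
    exact ⟨A, (hr.toCharTree_mem_subtrees_iff hk hC hCA).1 hB, rfl⟩
  · rintro ⟨A, hA, rfl⟩
    exact (hr.toCharTree_mem_subtrees_iff hk hC (mem_subKTrees.1 hA).1).2 hA

end CharTree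

/-- For any `k`-tree `T` and any `k`-clique `C` of `T`,
`μ(T; C) = μ(T'_C; C) + k - 1`, where `T'_C` is the characteristic `1`-tree of `T` with
respect to `C` (whose vertex `none` plays the role of `C`). -/
theorem kMean_eq_charTree_meanOrder {V : Type*} [Fintype V] [DecidableEq V]
    (k : ℕ) (hk : 1 ≤ k) (G : SimpleGraph V) (hG : IsKTree G k)
    (C : Finset V) (hC : G.IsNClique k C) :
    kMean G k C = meanOrder (charTree G k C) none + k - 1 := by
  obtain ⟨r, hr⟩ := IsKTreeOn.exists_isElimRank hG (subset_univ C) hC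
  have hinj : Set.InjOn (toCharTree C) (subKTrees G k C : Set (Finset V)) := fun A hA B hB h =>
    toCharTree_injOn (mem_subKTrees.1 hA).1 (mem_subKTrees.1 hB).1 h
  have hne : ((subKTrees G k C).card : ℝ) ≠ 0 :=
    Nat.cast_ne_zero.2 (card_ne_zero_of_mem (mem_subKTrees.2 ⟨Subset.rfl, .base C hC⟩))
  have hsum : ∑ A ∈ subKTrees G k C, (A.card : ℝ) =
      ∑ A ∈ subKTrees G k C, (((toCharTree C A).card : ℝ) + (k - 1)) := by
    refine sum_congr rfl fun A hA => ?_
    have := card_toCharTree (mem_subKTrees.1 hA).1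
    rw [hC.card_eq] at this
    have : (A.card : ℝ) + 1 = (toCharTree C A).card + k := by exact_mod_cast this
    linarith
  rw [kMean, meanOrder, hr.subtrees_charTree hk hC, sum_image hinj, card_image_of_injOn hinj,
    hsum, sum_add_distrib, sum_const, nsmul_eq_mul]
  field_simp
  ring
end
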